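/- arXiv:2211.11168 — 3 statements merged into one kernel-verified Lean document; each statement's English description precedes it below -/
import Mathlib

section
/- Let W be the Weyl group of a Kac–Moody group, w̲ = (w_1,…,w_n) ∈ Wⁿ, and for each i let 𝐰_i be a reduced expression of w_i; write the concatenation (𝐰_1, 𝐰_2, …, 𝐰_n) as (s_1, …, s_m), so m = ℓ(w_1)+⋯+ℓ(w_n). Let v ∈ W with v ≤ m_∗(w̲) and ℓ(v) = m − 1. Then the number of indices l ∈ {1,…,m} such that v = s_1⋯ŝ_l⋯s_m (the product omitting s_l) is exactly 1 or 2. -/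
open Pointwise Topology

noncomputable section

namespace TotPos

/-! ### Coxeter combinatorics: Bruhat order (subword property) and Demazure product -/

section Coxeter

variable {B W : Type} [Group W] {M : CoxeterMatrix B}

/-- The Bruhat order on a Coxeter group, via the subword property. -/
def BruhatLE (cs : CoxeterSystem M W) (v w : W) : Prop :=
  ∃ ω : List B, cs.IsReduced ω ∧ cs.wordProd ω = w ∧
    ∃ ω' : List B, ω'.Sublist ω ∧ cs.wordProd ω' = v

def BruhatLT (cs : CoxeterSystem M W) (v w : W) : Prop :=
  BruhatLE cs v w ∧ v ≠ w

/-- `dem` is the Demazure (star) product of the Coxeter system `cs`: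
the associative monoid operation determined by `x ∗ y = x y` when lengths add and
`s ∗ w = w` when `s w < w` for a simple reflection `s`. -/
structure IsDemazure (cs : CoxeterSystem M W) (dem : W → W → W) : Prop where
  assoc : ∀ x y z, dem (dem x y) z = dem x (dem y z)
  eq_mul : ∀ x y, cs.length (x * y) = cs.length x + cs.length y → dem x y = x * y
  absorb : ∀ (i : B) (w : W), cs.length (cs.simple i * w) < cs.length w →
    dem (cs.simple i) w = w

/-- `m_∗(w_1, …, w_n) = w_1 ∗ w_2 ∗ ⋯ ∗ w_n`. -/
def demProd {n : ℕ} (dem : W → W → W) (w : Fin n → W) : W :=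
  (List.ofFn w).foldr dem 1

/-- `m_•(w_1, …, w_n) = w_1 w_2 ⋯ w_n`. -/
def seqProd {n : ℕ} (w : Fin n → W) : W := (List.ofFn w).prod

/-- componentwise Bruhat order on `Wⁿ` -/
def seqLE (cs : CoxeterSystem M W) {n : ℕ} (v w : Fin n → W) : Prop :=
  ∀ i, BruhatLE cs (v i) (w i)

/-- `v̲` is positive in `w̲`. -/
def IsPositiveSeq (cs : CoxeterSystem M W) {n : ℕ} (v w : Fin n → W) : Prop :=
  seqLE cs v w ∧
  ∀ (i : Fin n) (v' : Fin n → W),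
    (∀ j, j < i → BruhatLE cs (v' j) (v j)) →
    BruhatLE cs (v' i) (w i) →
    ((List.ofFn v').take ((i : ℕ) + 1)).prod = ((List.ofFn v).take ((i : ℕ) + 1)).prod →
    ∀ j, j ≤ i → v' j = v j

/-- the product of the first `k` letters of the subexpression `ε` of the word `ω`. -/
def subwordProd (cs : CoxeterSystem M W) (ω : List B) (ε : Fin ω.length → Bool)
    (k : ℕ) : W :=
  ((List.ofFn fun j => if ε j then cs.simple (ω.get j) else 1).take k).prod

/-- `ε` is a positive subexpression of the reduced word `ω`, with total product `v`
(Marsh–Rietsch). -/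
def IsPositiveSubexpr (cs : CoxeterSystem M W) (ω : List B)
    (ε : Fin ω.length → Bool) (v : W) : Prop :=
  subwordProd cs ω ε ω.length = v ∧
  ∀ j : Fin ω.length,
    BruhatLT cs (subwordProd cs ω ε (j : ℕ))
      (subwordProd cs ω ε (j : ℕ) * cs.simple (ω.get j))

end Coxeter

/-! ### Poset combinatorics, relative to a relation -/

section Posets

variable {α : Type*}

/-- covering relation of the partial order `r` -/
def CovR (r : α → α → Prop) (x y : α) : Prop :=
  r x y ∧ x ≠ y ∧ ∀ z, r x z → r z y → z = x ∨ z = y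

/-- `l` is a maximal (saturated) chain from `x` to `y` -/
def IsMaxChainList (r : α → α → Prop) (x y : α) (l : List α) : Prop :=
  l.Chain' (CovR r) ∧ l.head? = some x ∧ l.getLast? = some y

/-- the poset `r` is pure: maximal chains between comparable elements exist and all
have the same length. -/
def PureR (r : α → α → Prop) : Prop :=
  ∀ x y, r x y → (∃ l, IsMaxChainList r x y l) ∧
    ∀ l l', IsMaxChainList r x y l → IsMaxChainList r x y l' → l.length = l'.length

/-- the poset `r` is thin: every interval of length 2 has exactly four elements. -/
def ThinR (r : α → α → Prop) : Prop :=
  ∀ x y, (∃ z, CovR r x z ∧ CovR r z y) → {z | r x z ∧ r z y}.ncard = 4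

/-- `c` is a maximal chain of the subposet `s` of `r`; maximal chains are the maximal
faces of the order complex. -/
def IsMaxChainFinset (r : α → α → Prop) (s : Set α) (c : Finset α) : Prop :=
  ↑c ⊆ s ∧ IsChain r ↑c ∧
    ∀ c' : Finset α, ↑c' ⊆ s → IsChain r ↑c' → c ⊆ c' → c = c'

/-- The (finite) subposet `s` of `r` is shellable: its maximal chains can be
enumerated `F 0, F 1, …` so that each `F k ∩ (F 0 ∪ ⋯ ∪ F (k-1))` is a nonempty union
of maximal proper faces of the simplex `F k`.  (Faces of the order complex contained
in a chain `F k` are just the subsets of `F k`.) -/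
def ShellableR (r : α → α → Prop) (s : Set α) : Prop :=
  ∃ (N : ℕ) (F : Fin N → Finset α), Function.Injective F ∧
    (∀ c, IsMaxChainFinset r s c ↔ ∃ k, F k = c) ∧
    ∀ k : Fin N, 0 < (k : ℕ) →
      ∃ S : Finset α, S.Nonempty ∧ S ⊆ F k ∧
        ∀ c : Finset α, (c ⊆ F k ∧ ∃ i, i < k ∧ c ⊆ F i) ↔
          ∃ a ∈ S, (c : Set α) ⊆ ↑(F k) \ {a}

end Posets

/-! ### Regular CW complexes -/

section CW

/-- `X = ⊔ strata i` is a regular CW complex: finitely many strata, the closure of each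
stratum is the homeomorphic image of a closed ball with the stratum corresponding to the
open ball, and the closure of each stratum is a union of strata. -/
def IsRegularCW {X ι : Type} [TopologicalSpace X] (strata : ι → Set X) : Prop :=
  Finite ι ∧
  (Pairwise fun i j => Disjoint (strata i) (strata j)) ∧
  (∀ i : ι, ∃ (d : ℕ)
    (e : ↥(Metric.closedBall (0 : EuclideanSpace ℝ (Fin d)) 1) ≃ₜ ↥(closure (strata i))),
    ∀ x, ((e x : X) ∈ strata i ↔ ‖(x : EuclideanSpace ℝ (Fin d))‖ < 1)) ∧
  (∀ i : ι, ∃ s : Set ι, closure (strata i) = ⋃ j ∈ s, strata j)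

/-- `X` is homeomorphic to a closed ball of dimension `d`. -/
def HomeoToClosedBall (X : Type) [TopologicalSpace X] (d : ℕ) : Prop :=
  Nonempty (X ≃ₜ ↥(Metric.closedBall (0 : EuclideanSpace ℝ (Fin d)) 1))

end CW

/-! ### The group-theoretic setting: pinned Kac–Moody-type group, flag variety,
twisted products, total positivity -/

section Grp

variable {B W G : Type} [Group W] {M : CoxeterMatrix B} [Group G] [TopologicalSpace G]

/-- `U⁻_{≥0}` (resp. `U⁺_{≥0}`): the submonoid generated by the `y i (a)` (resp `x i a`)
for real `a > 0`. -/
def Unn (y : B → ℂ → G) : Set G :=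
  (Submonoid.closure {g : G | ∃ (i : B) (a : ℝ), 0 < a ∧ g = y i (a : ℂ)} : Set G)

/-- double coset `A g C` -/
def dcos (A C : Subgroup G) (g : G) : Set G := (A : Set G) * {g} * (C : Set G)

/-- the defining relation of the twisted product
`𝓩 = G ×^{B⁺} G ×^{B⁺} ⋯ ×^{B⁺} G/B⁺`. -/
def twistRel (Bp : Subgroup G) (n : ℕ) (g h : Fin n → G) : Prop :=
  ∃ b : Fin n → G, (∀ i, b i ∈ Bp) ∧
    ∀ i : Fin n, h i = (if (i : ℕ) = 0 then (1 : G)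
      else b ⟨(i : ℕ) - 1, lt_of_le_of_lt (Nat.sub_le _ _) i.isLt⟩)⁻¹ * g i * b i

/-- the twisted product `𝓩 = G ×^{B⁺} ⋯ ×^{B⁺} G/B⁺` (`n` factors), as a quotient
topological space. -/
def Zspace (Bp : Subgroup G) (n : ℕ) : Type := Quot (twistRel Bp n)

instance (Bp : Subgroup G) (n : ℕ) : TopologicalSpace (Zspace Bp n) :=
  instTopologicalSpaceQuot

def mkZ (Bp : Subgroup G) (n : ℕ) (g : Fin n → G) : Zspace Bp n := Quot.mk _ g

/-- the Schubert cell `𝓩̊_{w̲} = B⁺ẇ_1B⁺ ×^{B⁺} ⋯ ×^{B⁺} B⁺ẇ_nB⁺/B⁺` -/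
def schubertZ (Bp : Subgroup G) (dot : W → G) {n : ℕ} (w : Fin n → W) :
    Set (Zspace Bp n) :=
  {z | ∃ g : Fin n → G, z = mkZ Bp n g ∧ ∀ i, g i ∈ dcos Bp Bp (dot (w i))}

/-- the opposite Schubert cell `𝓩̊ᵛ = m⁻¹(B⁻v̇B⁺/B⁺)`, `m` the convolution product -/
def oppSchubertZ (Bp Bm : Subgroup G) (dot : W → G) {n : ℕ} (v : W) :
    Set (Zspace Bp n) :=
  {z | ∃ g : Fin n → G, z = mkZ Bp n g ∧ (List.ofFn g).prod ∈ dcos Bm Bp (dot v)}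

/-- the open Richardson variety `𝓩̊_{v,w̲} = 𝓩̊_{w̲} ∩ 𝓩̊ᵛ` -/
def openRichZ (Bp Bm : Subgroup G) (dot : W → G) {n : ℕ} (v : W) (w : Fin n → W) :
    Set (Zspace Bp n) :=
  schubertZ Bp dot w ∩ oppSchubertZ Bp Bm dot v

/-- the totally nonnegative part `𝓩_{≥0}`: the Hausdorff closure of
`(U⁻_{≥0}, …, U⁻_{≥0}B⁺/B⁺)`. -/
def Znn (Bp : Subgroup G) (y : B → ℂ → G) (n : ℕ) : Set (Zspace Bp n) :=
  closure (mkZ Bp n '' {g | ∀ i, g i ∈ Unn y})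

/-- the totally positive stratum `𝓩_{v,w̲,>0} = 𝓩_{≥0} ∩ 𝓩̊_{v,w̲}` -/
def posZ (Bp Bm : Subgroup G) (y : B → ℂ → G) (dot : W → G) {n : ℕ}
    (v : W) (w : Fin n → W) : Set (Zspace Bp n) :=
  Znn Bp y n ∩ openRichZ Bp Bm dot v w

/-- the Marsh–Rietsch set `G_{𝐯₊,𝐰,>0}` attached to a reduced word `ω` and a
(positive) subexpression `ε`. -/
def MRCell (cs : CoxeterSystem M W) (y : B → ℂ → G) (dot : W → G)
    (ω : List B) (ε : Fin ω.length → Bool) : Set G :=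
  {g | ∃ c : Fin ω.length → ℝ, (∀ j, 0 < c j) ∧
    g = (List.ofFn fun j =>
      if ε j then dot (cs.simple (ω.get j)) else y (ω.get j) ((c j : ℝ) : ℂ)).prod}

end Grp


/-! ### Flag varieties, double Bruhat cells, duality -/

section Flag

variable {B W G : Type} [Group W] {M : CoxeterMatrix B} [Group G] [TopologicalSpace G]

def flagMk (Bp : Subgroup G) (g : G) : G ⧸ Bp := QuotientGroup.mk g

/-- the Schubert cell `𝓑̊_w = B⁺ẇB⁺/B⁺` -/
def schubertF (Bp : Subgroup G) (dot : W → G) (w : W) : Set (G ⧸ Bp) :=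
  flagMk Bp '' dcos Bp Bp (dot w)

/-- the opposite Schubert cell `𝓑̊ᵛ = B⁻v̇B⁺/B⁺` -/
def oppSchubertF (Bp Bm : Subgroup G) (dot : W → G) (v : W) : Set (G ⧸ Bp) :=
  flagMk Bp '' dcos Bm Bp (dot v)

/-- the open Richardson variety `𝓑̊_{v,w} = 𝓑̊_w ∩ 𝓑̊ᵛ` -/
def richF (Bp Bm : Subgroup G) (dot : W → G) (v w : W) : Set (G ⧸ Bp) :=
  schubertF Bp dot w ∩ oppSchubertF Bp Bm dot v

/-- the totally nonnegative flag variety `𝓑_{≥0}`, the Hausdorff closure of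
`U⁻_{≥0} B⁺/B⁺` -/
def flagNN (Bp : Subgroup G) (y : B → ℂ → G) : Set (G ⧸ Bp) :=
  closure (flagMk Bp '' Unn y)

/-- the totally positive Richardson stratum `𝓑_{v,w,>0} = 𝓑_{≥0} ∩ 𝓑̊_{v,w}` -/
def posF (Bp Bm : Subgroup G) (y : B → ℂ → G) (dot : W → G) (v w : W) :
    Set (G ⧸ Bp) :=
  flagNN Bp y ∩ richF Bp Bm dot v w

/-- the totally nonnegative monoid `G_{≥0}`, generated by `U⁺_{≥0}`, `U⁻_{≥0}` and
`T_{>0}` -/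
def Gnn (x y : B → ℂ → G) (Tpos : Set G) : Set G :=
  (Submonoid.closure ({g : G | ∃ (i : B) (a : ℝ), 0 < a ∧ g = x i (a : ℂ)} ∪
    {g : G | ∃ (i : B) (a : ℝ), 0 < a ∧ g = y i (a : ℂ)} ∪ Tpos) : Set G)

/-- the double Bruhat cell `G^{v,w} = B⁺ẇB⁺ ∩ B⁻v̇B⁻` -/
def dBruhatCell (Bp Bm : Subgroup G) (dot : W → G) (v w : W) : Set G :=
  dcos Bp Bp (dot w) ∩ dcos Bm Bm (dot v)

/-- the image of a subset of `𝓩` under the duality map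
`Φ(g_1, …, g_n) = (ι(ẇ_0⁻¹g_1⋯g_n), ι(g_n⁻¹), …, ι(g_2⁻¹))`. -/
def PhiSet (Bp : Subgroup G) (ι : G →* G) (dot : W → G) (w0 : W) (n : ℕ)
    (S : Set (Zspace Bp n)) : Set (Zspace Bp n) :=
  {z | ∃ g : Fin n → G, mkZ Bp n g ∈ S ∧
    z = mkZ Bp n (fun j => if h : (j : ℕ) = 0
      then ι ((dot w0)⁻¹ * (List.ofFn g).prod)
      else ι (g ⟨n - (j : ℕ), Nat.sub_lt j.pos (Nat.pos_of_ne_zero h)⟩)⁻¹)}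

end Flag

section CoxeterExchange

variable {B W : Type} [Group W] {M : CoxeterMatrix B} (cs : CoxeterSystem M W)

open Classical in
/-- The involution `(t, e) ↦ (s t s, e + [t = s])` attached to the simple reflection `s`. -/
def reflectionPerm (i : B) : Equiv.Perm (W × ZMod 2) :=
  Function.Involutive.toPerm
    (fun p => (cs.simple i * p.1 * cs.simple i, p.2 + if p.1 = cs.simple i then 1 else 0)) (by
      rintro ⟨t, e⟩
      have h : cs.simple i * t * cs.simple i = cs.simple i ↔ t = cs.simple i := by
        rw [mul_eq_right, mul_eq_one_iff_inv_eq, cs.inv_simple, eq_comm]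
      ext
      · simp [mul_assoc]
      · by_cases ht : t = cs.simple i <;> simp [h, ht, add_assoc, CharTwo.add_self_eq_zero])

open Classical in
theorem reflectionPerm_apply (i : B) (t : W) (e : ZMod 2) :
    reflectionPerm cs i (t, e) =
      (cs.simple i * t * cs.simple i, e + if t = cs.simple i then 1 else 0) := rfl

theorem conj_eq_simple_mul_pow_iff (i j : B) (k d : ℕ) (t : W) :
    (cs.simple i * cs.simple j) ^ k * t * ((cs.simple i * cs.simple j) ^ k)⁻¹ =
        cs.simple j * (cs.simple i * cs.simple j) ^ d ↔
      t = cs.simple j * (cs.simple i * cs.simple j) ^ (2 * k + d) := by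
  have h : ((cs.simple i * cs.simple j) ^ k)⁻¹ * cs.simple j =
      cs.simple j * (cs.simple i * cs.simple j) ^ k := by
    induction k with
    | zero => simp
    | succ k ih =>
      rw [pow_succ', mul_inv_rev, mul_assoc, mul_inv_rev, cs.inv_simple, cs.inv_simple]
      rw [mul_assoc, ← mul_assoc _ (cs.simple j), ih, ← pow_succ', pow_succ]
      simp [mul_assoc]
  rw [mul_inv_eq_iff_eq_mul, ← eq_inv_mul_iff_mul_eq, ← mul_assoc, ← mul_assoc, h, two_mul,
    pow_add, pow_add, mul_assoc, mul_assoc, mul_assoc, ← pow_add, ← pow_add, ← pow_add,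
    ← pow_add, add_comm d k]

open Classical in
theorem reflectionPerm_mul_pow_apply (i j : B) (k : ℕ) (t : W) (e : ZMod 2) :
    ((reflectionPerm cs i * reflectionPerm cs j) ^ k) (t, e) =
      ((cs.simple i * cs.simple j) ^ k * t * ((cs.simple i * cs.simple j) ^ k)⁻¹,
        e + ∑ r ∈ Finset.range (2 * k),
          if t = cs.simple j * (cs.simple i * cs.simple j) ^ r then 1 else 0) := by
  induction k with
  | zero => simp
  | succ k ih =>
    have h0 := conj_eq_simple_mul_pow_iff cs i j k 0 t
    have h1 := conj_eq_simple_mul_pow_iff cs i j k 1 t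
    simp only [pow_zero, mul_one, add_zero, pow_one] at h0 h1
    have h2 (x : W) : cs.simple j * x * cs.simple j = cs.simple i ↔
        x = cs.simple j * (cs.simple i * cs.simple j) := by
      rw [← eq_mul_inv_iff_mul_eq, ← eq_inv_mul_iff_mul_eq, cs.inv_simple]
    rw [pow_succ', Equiv.Perm.mul_apply, ih, Equiv.Perm.mul_apply, reflectionPerm_apply,
      reflectionPerm_apply]
    ext
    · simp [pow_succ', mul_assoc]
    · simp only [h0, h1, h2]
      rw [show 2 * (k + 1) = 2 * k + 1 + 1 by ring, Finset.sum_range_succ, Finset.sum_range_succ]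
      ring

theorem isLiftable_reflectionPerm : M.IsLiftable (reflectionPerm cs) := by
  classical
  intro i j
  ext1 ⟨t, e⟩
  rw [reflectionPerm_mul_pow_apply, two_mul, Finset.sum_range_add]
  simp [pow_add, CharTwo.add_self_eq_zero]

open Classical in
theorem lift_reflectionPerm_wordProd_apply (ω : List B) (t : W) (e : ZMod 2) :
    cs.lift ⟨reflectionPerm cs, isLiftable_reflectionPerm cs⟩ (cs.wordProd ω) (t, e) =
      (cs.wordProd ω * t * (cs.wordProd ω)⁻¹, e + ((cs.rightInvSeq ω).count t : ℕ)) := by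
  induction ω with
  | nil => simp
  | cons i ω ih =>
    have h : cs.wordProd ω * t * (cs.wordProd ω)⁻¹ = cs.simple i ↔
        (cs.wordProd ω)⁻¹ * cs.simple i * cs.wordProd ω = t := by
      rw [mul_inv_eq_iff_eq_mul, mul_assoc, inv_mul_eq_iff_eq_mul, eq_comm]
    rw [cs.wordProd_cons, map_mul, Equiv.Perm.mul_apply, ih, cs.lift_apply_simple,
      reflectionPerm_apply]
    ext
    · simp [mul_assoc]
    · simp [CoxeterSystem.rightInvSeq, List.count_cons, h, add_assoc]

/-- Reduced words of the same element have the same right inversions. -/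
theorem mem_rightInvSeq_of_wordProd_eq {ω ω' : List B} (hω : cs.IsReduced ω)
    (h : cs.wordProd ω = cs.wordProd ω') {t : W} (ht : t ∈ cs.rightInvSeq ω) :
    t ∈ cs.rightInvSeq ω' := by
  classical
  by_contra ht'
  have h1 := lift_reflectionPerm_wordProd_apply cs ω t 0
  rw [h, lift_reflectionPerm_wordProd_apply, List.count_eq_zero_of_not_mem ht',
    List.count_eq_one_of_mem hω.nodup_rightInvSeq ht] at h1
  simp at h1

theorem exists_wordProd_eraseIdx_eq {ω ω' : List B} (hω : cs.IsReduced ω)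
    (h : cs.wordProd ω = cs.wordProd ω') {j : ℕ} (hj : j < ω.length) :
    ∃ l < ω'.length, cs.wordProd (ω'.eraseIdx l) = cs.wordProd (ω.eraseIdx j) := by
  have hj' : j < (cs.rightInvSeq ω).length := by simpa
  obtain ⟨l, hl, hlt⟩ := List.getElem_of_mem
    (mem_rightInvSeq_of_wordProd_eq cs hω h (List.getElem_mem hj'))
  refine ⟨l, by simpa using hl, ?_⟩
  rw [← cs.wordProd_mul_getD_rightInvSeq, ← cs.wordProd_mul_getD_rightInvSeq, h,
    List.getD_eq_getElem _ _ hl, List.getD_eq_getElem _ _ hj', hlt]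

theorem _root_.List.Sublist.exists_eq_eraseIdx {α : Type*} {l l' : List α} (h : l'.Sublist l)
    (hlen : l'.length + 1 = l.length) : ∃ j < l.length, l' = l.eraseIdx j := by
  induction h with
  | slnil => simp at hlen
  | cons a h ih =>
    refine ⟨0, by simp, ?_⟩
    simpa using h.eq_of_length (by simpa using hlen)
  | cons_cons a h ih =>
    obtain ⟨j, hj, rfl⟩ := ih (by simpa using hlen)
    exact ⟨j + 1, by simpa using hj, by simp⟩

theorem exists_eq_append_cons_append_cons {α : Type*} (L : List α) {i j : ℕ} (hij : i < j)
    (hj : j < L.length) : ∃ (X : List α) (a : α) (Y : List α) (b : α) (Z : List α),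
      L = X ++ a :: (Y ++ b :: Z) ∧ X.length = i ∧ X.length + 1 + Y.length = j := by
  refine ⟨L.take i, L[i], (L.drop (i + 1)).take (j - (i + 1)), L[j], L.drop (j + 1), ?_, ?_, ?_⟩
  · have h : L.drop j = (L.drop (i + 1)).drop (j - (i + 1)) := by
      rw [List.drop_drop]; congr 1; omega
    rw [← List.drop_eq_getElem_cons hj, h, List.take_append_drop, ← List.drop_eq_getElem_cons,
      List.take_append_drop]
  · simp; omega
  · simp; omega

/-- If erasing the letter `i` or the letter `j > i` of `L` gives the same product, then erasing
any later letter gives an element of length at most `|L| - 3`. -/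
theorem length_wordProd_eraseIdx_add_three_le {L : List B} {i j k : ℕ} (hij : i < j) (hjk : j < k)
    (hk : k < L.length) (h : cs.wordProd (L.eraseIdx i) = cs.wordProd (L.eraseIdx j)) :
    cs.length (cs.wordProd (L.eraseIdx k)) + 3 ≤ L.length := by
  obtain ⟨X, a, Y, b, Z, rfl, rfl, rfl⟩ :=
    exists_eq_append_cons_append_cons L hij (hjk.trans hk)
  obtain ⟨d, rfl⟩ := Nat.exists_eq_add_of_lt hjk
  have e1 : (X ++ a :: (Y ++ b :: Z)).eraseIdx X.length = X ++ (Y ++ b :: Z) := by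
    simp [List.eraseIdx_append_of_length_le]
  have e2 : (X ++ a :: (Y ++ b :: Z)).eraseIdx (X.length + 1 + Y.length) =
      X ++ a :: (Y ++ Z) := by
    rw [add_assoc, List.eraseIdx_append_of_length_le (by omega), Nat.add_sub_cancel_left,
      add_comm 1, List.eraseIdx_cons_succ, List.eraseIdx_append_of_length_le le_rfl]
    simp
  have e3 : (X ++ a :: (Y ++ b :: Z)).eraseIdx (X.length + 1 + Y.length + d + 1) =
      X ++ a :: (Y ++ b :: Z.eraseIdx d) := by
    rw [show X.length + 1 + Y.length + d + 1 = X.length + (Y.length + (d + 1) + 1) by ring,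
      List.eraseIdx_append_of_length_le (by omega), Nat.add_sub_cancel_left,
      List.eraseIdx_cons_succ, List.eraseIdx_append_of_length_le (by omega),
      Nat.add_sub_cancel_left, List.eraseIdx_cons_succ]
  rw [e1, e2] at h
  simp only [cs.wordProd_append, cs.wordProd_cons, ← mul_assoc, mul_left_inj] at h
  have h' : cs.wordProd Y * cs.simple b = cs.simple a * cs.wordProd Y := by
    simpa [mul_assoc] using h
  have e4 : cs.wordProd (X ++ a :: (Y ++ b :: Z.eraseIdx d)) =
      cs.wordProd (X ++ (Y ++ Z.eraseIdx d)) := by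
    simp only [cs.wordProd_append, cs.wordProd_cons]
    rw [← mul_assoc (cs.wordProd Y), h']
    simp [mul_assoc]
  have hle := cs.length_wordProd_le (X ++ (Y ++ Z.eraseIdx d))
  have hd : d < Z.length := by simp at hk; omega
  rw [e3, e4]
  simp [List.length_eraseIdx_of_lt hd] at hle ⊢
  omega

variable {cs} {dem : W → W → W}

theorem IsDemazure.wordProd_eq_foldr (hdem : IsDemazure cs dem) {ω : List B}
    (hω : cs.IsReduced ω) (x : W) :
    dem (cs.wordProd ω) x = (ω.map cs.simple).foldr dem x := by
  induction ω with
  | nil => simpa using hdem.eq_mul 1 x (by simp)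
  | cons i ω ih =>
    have hω' : cs.IsReduced ω := by simpa using hω.drop 1
    have h := hdem.eq_mul (cs.simple i) (cs.wordProd ω) (by
      rw [← cs.wordProd_cons, hω.eq, hω'.eq, cs.length_simple, List.length_cons, add_comm])
    rw [cs.wordProd_cons, ← h, hdem.assoc, ih hω']
    rfl

theorem IsDemazure.foldr_wordProd (hdem : IsDemazure cs dem) (Ls : List (List B))
    (hLs : ∀ ω ∈ Ls, cs.IsReduced ω) :
    (Ls.map cs.wordProd).foldr dem 1 = (Ls.flatten.map cs.simple).foldr dem 1 := by
  induction Ls with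
  | nil => rfl
  | cons ω Ls ih =>
    simp only [List.forall_mem_cons] at hLs
    simp [hdem.wordProd_eq_foldr hLs.1, ih hLs.2]

theorem IsDemazure.exists_reduced_sublist (hdem : IsDemazure cs dem) (ω : List B) :
    ∃ ω' : List B, ω'.Sublist ω ∧ cs.IsReduced ω' ∧
      (ω.map cs.simple).foldr dem 1 = cs.wordProd ω' := by
  induction ω with
  | nil => exact ⟨[], List.Sublist.refl _, by simp [CoxeterSystem.IsReduced], by simp⟩
  | cons i ω ih =>
    obtain ⟨ω', hsub, hred, heq⟩ := ih
    rcases cs.length_simple_mul (cs.wordProd ω') i with h | h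
    · refine ⟨i :: ω', hsub.cons_cons i, ?_, ?_⟩
      · rw [CoxeterSystem.IsReduced, cs.wordProd_cons, h, hred.eq, List.length_cons]
      · rw [List.map_cons, List.foldr_cons, heq, cs.wordProd_cons]
        exact hdem.eq_mul _ _ (by rw [h, cs.length_simple, add_comm])
    · refine ⟨ω', hsub.cons i, hred, ?_⟩
      rw [List.map_cons, List.foldr_cons, heq]
      exact hdem.absorb _ _ (by omega)

theorem IsDemazure.exists_wordProd_eraseIdx_eq (hdem : IsDemazure cs dem) {L : List B} {v : W}
    (hv : BruhatLE cs v ((L.map cs.simple).foldr dem 1)) (hlen : cs.length v + 1 = L.length) :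
    ∃ l < L.length, cs.wordProd (L.eraseIdx l) = v := by
  obtain ⟨L', hsub, hred, heq⟩ := hdem.exists_reduced_sublist L
  obtain ⟨ω, hω, hωL, ω', hsub', rfl⟩ := hv
  rw [heq] at hωL
  have hlenω : ω.length = L'.length := by rw [← hω.eq, hωL, hred.eq]
  have h1 := hsub.length_le
  have h2 := hsub'.length_le
  have h3 := cs.length_wordProd_le ω'
  rcases h2.eq_or_lt with h | h
  · obtain rfl := hsub'.eq_of_length h
    rw [hω.eq] at hlen
    obtain ⟨l, hl, rfl⟩ := hsub.exists_eq_eraseIdx (by omega)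
    exact ⟨l, hl, hωL.symm⟩
  · obtain rfl := hsub.eq_of_length (by omega)
    obtain ⟨j, hj, rfl⟩ := hsub'.exists_eq_eraseIdx (by omega)
    exact TotPos.exists_wordProd_eraseIdx_eq cs hω hωL hj

end CoxeterExchange

/-- **Bao–He, claim (a) in the proof of Theorem `thm:hatQ`**: if `v ≤ m_∗(w̲)` and
`ℓ(v) = m − 1` where `(s_1, …, s_m)` is the concatenation of reduced words for
`w_1, …, w_n`, then the number of indices `l` with `v = s_1⋯ŝ_l⋯s_m` is `1` or `2`. -/
theorem statement_5
    {B W : Type} [Group W] {M : CoxeterMatrix B}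
    (cs : CoxeterSystem M W) (dem : W → W → W) (hdem : IsDemazure cs dem)
    (n : ℕ) (w : Fin n → W) (ω : Fin n → List B)
    (hred : ∀ i, cs.IsReduced (ω i)) (hω : ∀ i, cs.wordProd (ω i) = w i)
    (v : W) (hv : BruhatLE cs v (demProd dem w))
    (L : List B) (hL : L = (List.ofFn ω).flatten)
    (hlen : cs.length v + 1 = L.length) :
    {l : Fin L.length | cs.wordProd (L.eraseIdx (l : ℕ)) = v}.ncard = 1 ∨
    {l : Fin L.length | cs.wordProd (L.eraseIdx (l : ℕ)) = v}.ncard = 2 := by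
  have hdemL : demProd dem w = (L.map cs.simple).foldr dem 1 := by
    rw [hL, ← hdem.foldr_wordProd (List.ofFn ω) (by simpa [List.mem_ofFn] using hred),
      List.map_ofFn, demProd]
    congr 2
    exact funext fun i => (hω i).symm
  rw [hdemL] at hv
  obtain ⟨l, hl, hlv⟩ := hdem.exists_wordProd_eraseIdx_eq hv hlen
  have hno (a b c : Fin L.length) (ha : cs.wordProd (L.eraseIdx a) = v)
      (hb : cs.wordProd (L.eraseIdx b) = v) (hc : cs.wordProd (L.eraseIdx c) = v)
      (hab : a < b) (hbc : b < c) : False := by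
    have := length_wordProd_eraseIdx_add_three_le cs hab hbc c.isLt (ha.trans hb.symm)
    rw [hc] at this
    omega
  have hpos : 0 < {l : Fin L.length | cs.wordProd (L.eraseIdx (l : ℕ)) = v}.ncard :=
    (Set.ncard_pos).2 ⟨⟨l, hl⟩, hlv⟩
  have hle : {l : Fin L.length | cs.wordProd (L.eraseIdx (l : ℕ)) = v}.ncard ≤ 2 := by
    by_contra! h
    obtain ⟨a, b, c, ha, hb, hc, hab, hac, hbc⟩ := (Set.two_lt_ncard_iff).1 h
    rcases lt_or_gt_of_ne hab with h1 | h1 <;> rcases lt_or_gt_of_ne hac with h2 | h2 <;>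
      rcases lt_or_gt_of_ne hbc with h3 | h3
    all_goals first
      | exact hno _ _ _ ha hb hc ‹_› ‹_›
      | exact hno _ _ _ ha hc hb ‹_› ‹_›
      | exact hno _ _ _ hb ha hc ‹_› ‹_›
      | exact hno _ _ _ hb hc ha ‹_› ‹_›
      | exact hno _ _ _ hc ha hb ‹_› ‹_›
      | exact hno _ _ _ hc hb ha ‹_› ‹_›
  omega

end TotPos
end
end

section
/- Let X be a compact n-dimensional topological manifold with boundary such that the boundary ∂X is homeomorphic to the (n−1)-dimensional sphere and the interior X ∖ ∂X is homeomorphic to the n-dimensional open ball. Then X is homeomorphic to the n-dimensional closed ball. -/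
open Pointwise Topology

noncomputable section

namespace TotPos

section BallRecognition

/-- A self-homeomorphism of an open piece that is the identity off a closed set extends
by the identity. -/
lemma exists_homeomorph_extend {V X : Type*} [TopologicalSpace V] [TopologicalSpace X]
    {j : V → X} (hj : IsOpenEmbedding j) (k : V ≃ₜ V) {C : Set V} (hC : IsClosed (j '' C))
    (hk : ∀ v ∉ C, k v = v) :
    ∃ K : X ≃ₜ X, (∀ v, K (j v) = j (k v)) ∧ ∀ x ∉ Set.range j, K x = x := by
  have ext_apply : ∀ (f : V → V) (v : V), Function.extend j (j ∘ f) id (j v) = j (f v) :=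
    fun f v => hj.injective.extend_apply _ _ v
  have ext_off : ∀ (f : V → V) (x : X), x ∉ Set.range j →
      Function.extend j (j ∘ f) id x = x :=
    fun f x hx => Function.extend_apply' _ _ _ hx
  have cont : ∀ f : V → V, Continuous f → (∀ v ∉ C, f v = v) →
      Continuous (Function.extend j (j ∘ f) id) := by
    intro f hf hfC
    rw [continuous_iff_continuousAt]
    intro x
    by_cases hx : x ∈ Set.range j
    · obtain ⟨v, rfl⟩ := hx
      rw [← hj.continuousAt_iff]
      have : Function.extend j (j ∘ f) id ∘ j = j ∘ f := funext (ext_apply f)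
      rw [this]
      exact (hj.continuous.comp hf).continuousAt
    · have hmem : (j '' C)ᶜ ∈ 𝓝 x :=
        hC.isOpen_compl.mem_nhds fun ⟨v, _, hv⟩ => hx ⟨v, hv⟩
      refine continuousAt_id.congr ?_
      filter_upwards [hmem] with y hy
      by_cases hyj : y ∈ Set.range j
      · obtain ⟨v, rfl⟩ := hyj
        rw [ext_apply, hfC v fun hv => hy ⟨v, hv, rfl⟩]
        rfl
      · rw [ext_off f y hyj]
        rfl
  have inv : ∀ f g : V → V, Function.LeftInverse g f →
      Function.LeftInverse (Function.extend j (j ∘ g) id) (Function.extend j (j ∘ f) id) := by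
    intro f g h x
    by_cases hx : x ∈ Set.range j
    · obtain ⟨v, rfl⟩ := hx
      rw [ext_apply, ext_apply, h v]
    · rw [ext_off f x hx, ext_off g x hx]
  refine ⟨{ toFun := Function.extend j (j ∘ k) id
            invFun := Function.extend j (j ∘ k.symm) id
            left_inv := inv _ _ k.left_inv
            right_inv := inv _ _ k.right_inv
            continuous_toFun := cont k k.continuous hk
            continuous_invFun := cont k.symm k.symm.continuous
              fun v hv => (k.symm_apply_eq).2 (hk v hv).symm }, ext_apply k, ext_off k⟩

section Shrinking

variable {E : Type*} [NormedAddCommGroup E] [NormedSpace ℝ E]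

/-- The radial map of `E` that is the identity off the unit ball and that, in the
coordinate `v / (1 - ‖v‖)` of the open unit ball, is multiplication by `c`. -/
def radialScale (c : ℝ) (v : E) : E := (c / (1 - (1 - c) * min ‖v‖ 1)) • v

lemma radialScale_denom_pos {E : Type*} [NormedAddCommGroup E] {c : ℝ} (hc : 0 < c) (v : E) :
    0 < 1 - (1 - c) * min ‖v‖ 1 := by
  have h0 : 0 ≤ min ‖v‖ 1 := le_min (norm_nonneg v) zero_le_one
  have h1 : min ‖v‖ 1 ≤ 1 := min_le_right _ _
  rcases le_total c 1 with h | h <;> nlinarith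

lemma continuous_radialScale {c : ℝ} (hc : 0 < c) : Continuous (radialScale c : E → E) := by
  unfold radialScale
  have h : ∀ v : E, 1 - (1 - c) * min ‖v‖ 1 ≠ 0 := fun v => (radialScale_denom_pos hc v).ne'
  fun_prop (disch := assumption)

lemma radialScale_of_one_le {c : ℝ} (hc : 0 < c) {v : E} (hv : 1 ≤ ‖v‖) :
    radialScale c v = v := by
  rw [radialScale, min_eq_right hv, show 1 - (1 - c) * 1 = c by ring, div_self hc.ne', one_smul]

lemma norm_radialScale {c : ℝ} (hc : 0 < c) (v : E) :
    ‖radialScale c v‖ = c / (1 - (1 - c) * min ‖v‖ 1) * ‖v‖ := by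
  rw [radialScale, norm_smul, Real.norm_of_nonneg
    (div_pos hc (radialScale_denom_pos hc v)).le]

lemma radialScale_inv_radialScale {c : ℝ} (hc : 0 < c) (v : E) :
    radialScale c⁻¹ (radialScale c v) = v := by
  rcases le_total 1 ‖v‖ with hv | hv
  · rw [radialScale_of_one_le hc hv, radialScale_of_one_le (inv_pos.2 hc) hv]
  · have hd := radialScale_denom_pos hc v
    have hn := norm_radialScale hc v
    have hle : ‖radialScale c v‖ ≤ 1 := by
      rw [hn, div_mul_eq_mul_div, div_le_one hd, min_eq_left hv]
      nlinarith
    rw [radialScale, min_eq_left hle, hn]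
    rw [min_eq_left hv] at hd ⊢
    rw [radialScale, smul_smul, min_eq_left hv]
    have hd' := hd.ne'
    have key : 1 - (1 - c⁻¹) * (c / (1 - (1 - c) * ‖v‖) * ‖v‖) = (1 - (1 - c) * ‖v‖)⁻¹ := by
      have hc' := hc.ne'
      field_simp
      ring
    rw [key]
    have : c⁻¹ / (1 - (1 - c) * ‖v‖)⁻¹ * (c / (1 - (1 - c) * ‖v‖)) = 1 := by
      have hc' := hc.ne'
      field_simp
    rw [this, one_smul]

/-- `radialScale` as a homeomorphism. -/
def radialScaleHomeomorph {c : ℝ} (hc : 0 < c) : E ≃ₜ E where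
  toFun := radialScale c
  invFun := radialScale c⁻¹
  left_inv := radialScale_inv_radialScale hc
  right_inv v := by
    simpa using radialScale_inv_radialScale (inv_pos.2 hc) v
  continuous_toFun := continuous_radialScale hc
  continuous_invFun := continuous_radialScale (inv_pos.2 hc)

lemma norm_radialScale_le {c : ℝ} (hc : 0 < c) {v : E} (hv : ‖v‖ ≤ 1 / 2) :
    ‖radialScale c v‖ ≤ c := by
  have hd := radialScale_denom_pos hc v
  rw [norm_radialScale hc, div_mul_eq_mul_div, div_le_iff₀ hd, min_eq_left (by linarith)]
  nlinarith [norm_nonneg v, mul_nonneg hc.le (norm_nonneg v)]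

/-- A compact set in an open Euclidean piece of a Hausdorff space can be shrunk towards a
point of the piece by a homeomorphism supported in the piece. -/
lemma exists_homeomorph_shrink [ProperSpace E] {X : Type*} [TopologicalSpace X] [T2Space X]
    {j : E → X} (hj : IsOpenEmbedding j) {C : Set X} (hC : IsCompact C)
    (hCj : C ⊆ Set.range j) {p : X} (hp : p ∈ Set.range j) {N : Set X} (hN : N ∈ 𝓝 p) :
    ∃ k : X ≃ₜ X, (∀ x ∉ Set.range j, k x = x) ∧ k p = p ∧ Set.MapsTo k C N := by
  obtain ⟨x₀, rfl⟩ := hp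
  have hpre : IsCompact (j ⁻¹' C) := hj.isInducing.isCompact_preimage' hC hCj
  obtain ⟨R, hR0, hR⟩ : ∃ R : ℝ, 0 < R ∧ j ⁻¹' C ⊆ Metric.closedBall x₀ R := by
    obtain ⟨R, hR⟩ := hpre.isBounded.subset_closedBall x₀
    exact ⟨max R 1, by positivity, hR.trans (Metric.closedBall_subset_closedBall (le_max_left _ _))⟩
  let a : E ≃ₜ E := (Homeomorph.smulOfNeZero (2 * R) (by positivity)).trans (Homeomorph.addLeft x₀)
  have ha : ∀ v, a v = x₀ + (2 * R) • v := fun v => rfl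
  have hja : IsOpenEmbedding (j ∘ a) := hj.comp a.isOpenEmbedding
  have hra : Set.range (j ∘ a) = Set.range j := a.surjective.range_comp j
  have h0 : (j ∘ a) 0 = j x₀ := by simp [ha]
  have hN0 : (j ∘ a) ⁻¹' N ∈ 𝓝 (0 : E) :=
    hja.continuous.continuousAt.preimage_mem_nhds (by rwa [h0])
  obtain ⟨ε, hε, hεN⟩ := Metric.mem_nhds_iff.1 hN0
  have hc : 0 < ε / 2 := by positivity
  obtain ⟨k, hk1, hk2⟩ := exists_homeomorph_extend hja (radialScaleHomeomorph hc)
    (C := Metric.closedBall 0 1)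
    (((isCompact_closedBall (0 : E) 1).image hja.continuous).isClosed)
    (fun v hv => radialScale_of_one_le hc (by simpa using le_of_lt (by simpa using hv)))
  rw [hra] at hk2
  refine ⟨k, hk2, ?_, ?_⟩
  · rw [← h0, hk1]
    simp [radialScaleHomeomorph, radialScale]
  · intro x hx
    obtain ⟨w, rfl⟩ := hCj hx
    obtain ⟨v, rfl⟩ := a.surjective w
    have hv : ‖v‖ ≤ 1 / 2 := by
      have := hR hx
      rw [ha, Metric.mem_closedBall, dist_eq_norm, add_sub_cancel_left, norm_smul,
        Real.norm_of_nonneg (by positivity)] at this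
      by_contra! h
      nlinarith
    have : k (j (a v)) = (j ∘ a) (radialScaleHomeomorph hc v) := hk1 v
    rw [this]
    apply hεN
    rw [mem_ball_zero_iff]
    exact (norm_radialScale_le hc hv).trans_lt (by linarith)

end Shrinking

/-- If the level sets of a depth function near the compact set `{τ = 0}` are open cells, then
the complement of `{τ = 0}` is openly embedded as the complement of a point. -/
lemma exists_isOpenEmbedding_compl_singleton {E : Type*} [NormedAddCommGroup E]
    [NormedSpace ℝ E] [ProperSpace E] {X : Type*} [TopologicalSpace X] [T2Space X]
    [CompactSpace X] {τ : X → ℝ} (hτ : Continuous τ) {p : X} (hp : τ p = 0)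
    (hcell : ∀ ε : ℝ, 0 < ε → ε ≤ 1 →
      ∃ j : E → X, IsOpenEmbedding j ∧ Set.range j = {x | τ x < ε}) :
    ∃ f : {x : X // 0 < τ x} → X, IsOpenEmbedding f ∧ Set.range f = {p}ᶜ := by
  let ε : ℕ → ℝ := fun i => 1 / ((i : ℝ) + 1)
  have hε0 : ∀ i, 0 < ε i := fun i => Nat.one_div_pos_of_nat
  have hε1 : ∀ i, ε i ≤ 1 := fun i => by
    simp only [ε]; rw [div_le_one (by positivity)]; linarith [i.cast_nonneg (α := ℝ)]
  have hεanti : StrictAnti ε := strictAnti_nat_of_succ_lt fun i => by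
    simp only [ε]; push_cast; gcongr; linarith
  choose j hj hjr using fun i => hcell (ε i) (hε0 i) (hε1 i)
  have hpj : ∀ i, p ∈ Set.range (j i) := fun i => by
    rw [hjr]; simpa [hp] using hε0 i
  have : (𝓝 p).IsCountablyGenerated := by
    obtain ⟨v, hv⟩ := hpj 0
    rw [← hv, ← (hj 0).map_nhds_eq]
    infer_instance
  obtain ⟨N, hN⟩ := (𝓝 p).exists_antitone_basis
  have hstep : ∀ (i : ℕ) (g : {g : X ≃ₜ X // g p = p}), ∃ k : X ≃ₜ X,
      (∀ x, ε i ≤ τ x → k x = x) ∧ k p = p ∧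
      ∀ x, τ x ≤ ε (i + 1) → g.1 (k x) ∈ N i := by
    intro i g
    have hgN : g.1 ⁻¹' N i ∈ 𝓝 p :=
      g.1.continuous.continuousAt.preimage_mem_nhds (by rw [g.2]; exact hN.1.mem_of_mem trivial)
    obtain ⟨k, h1, h2, h3⟩ := exists_homeomorph_shrink (hj i)
      (C := {x | τ x ≤ ε (i + 1)}) (isClosed_le hτ continuous_const).isCompact
      (by rw [hjr]; exact fun x hx => lt_of_le_of_lt hx (hεanti i.lt_succ_self)) (hpj i) hgN
    exact ⟨k, fun x hx => h1 x (by rw [hjr]; exact not_lt.2 hx), h2, fun x hx => h3 hx⟩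
  choose k hk1 hk2 hk3 using hstep
  let g : ℕ → {g : X ≃ₜ X // g p = p} := fun i => Nat.rec ⟨Homeomorph.refl X, rfl⟩
    (fun i g => ⟨(k i g).trans g.1, by simp [hk2, g.2]⟩) i
  have hg : ∀ i x, (g (i + 1)).1 x = (g i).1 (k i (g i) x) := fun i x => rfl
  have hstab : ∀ i m x, ε i ≤ τ x → (g (i + m)).1 x = (g i).1 x := by
    intro i m x hx
    induction m with
    | zero => rfl
    | succ m ih =>
      rw [← add_assoc, hg, hk1 _ _ _ ((hεanti.antitone (Nat.le_add_right i m)).trans hx), ih]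
  have hstab' : ∀ i m x, ε i ≤ τ x → ε m ≤ τ x → (g m).1 x = (g i).1 x := by
    intro i m x hi hm
    rcases le_total i m with h | h
    · obtain ⟨r, rfl⟩ := Nat.exists_eq_add_of_le h
      exact hstab i r x hi
    · obtain ⟨r, rfl⟩ := Nat.exists_eq_add_of_le h
      exact (hstab m r x hm).symm
  have hex : ∀ x : {x : X // 0 < τ x}, ∃ i, ε i < τ x := fun x =>
    exists_nat_one_div_lt x.2
  choose idx hidx using hex
  let f : {x : X // 0 < τ x} → X := fun x => (g (idx x)).1 x
  have hf : ∀ (x : {x : X // 0 < τ x}) (i : ℕ), ε i ≤ τ x → f x = (g i).1 x :=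
    fun x i hi => hstab' i (idx x) x hi (hidx x).le
  have hopen : ∀ i, IsOpen {x : {x : X // 0 < τ x} | ε i < τ x} := fun i =>
    isOpen_lt continuous_const (hτ.comp continuous_subtype_val)
  have hcont : Continuous f := by
    rw [continuous_iff_continuousAt]
    intro x
    refine ((g (idx x)).1.continuous.comp continuous_subtype_val).continuousAt.congr ?_
    filter_upwards [(hopen (idx x)).mem_nhds (hidx x)] with y hy
    exact (hf y _ (le_of_lt hy)).symm
  have hinj : Function.Injective f := by
    intro x y hxy
    rcases le_total (idx x) (idx y) with h | h
    · have hx := (hεanti.antitone h).trans (hidx x).le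
      rw [hf x _ hx] at hxy
      exact Subtype.ext ((g (idx y)).1.injective hxy)
    · have hy := (hεanti.antitone h).trans (hidx y).le
      rw [hf y _ hy] at hxy
      exact Subtype.ext ((g (idx x)).1.injective hxy)
  have hpos : IsOpen {x : X | 0 < τ x} := isOpen_lt continuous_const hτ
  have hmap : IsOpenMap f := by
    rw [isOpenMap_iff_nhds_le]
    intro x
    have h1 : f =ᶠ[𝓝 x] (g (idx x)).1 ∘ Subtype.val := by
      filter_upwards [(hopen (idx x)).mem_nhds (hidx x)] with y hy
      exact hf y _ (le_of_lt hy)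
    rw [Filter.map_congr h1, h1.eq_of_nhds]
    exact ((g (idx x)).1.isOpenMap.comp hpos.isOpenMap_subtype_val).nhds_le x
  refine ⟨f, .of_continuous_injective_isOpenMap hcont hinj hmap, ?_⟩
  ext y
  simp only [Set.mem_range, Set.mem_compl_iff, Set.mem_singleton_iff]
  constructor
  · rintro ⟨x, rfl⟩ h
    have : (x : X) = p := (g (idx x)).1.injective (h.trans (g (idx x)).2.symm)
    have := x.2
    simp_all
  · intro hy
    obtain ⟨i, -, hi⟩ := hN.1.mem_iff.1 (isOpen_ne.mem_nhds (Ne.symm hy) : {z | z ≠ y} ∈ 𝓝 p)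
    set x := (g (i + 1)).1.symm y with hx
    have hgx : (g (i + 1)).1 x = y := (g (i + 1)).1.apply_symm_apply y
    have hτx : ε (i + 1) < τ x := by
      by_contra! h
      refine hi ?_ hgx
      rw [hg]
      exact hk3 i (g i) x h
    exact ⟨⟨x, (hε0 _).trans hτx⟩, (hf _ _ hτx.le).trans hgx⟩


section Collar

variable {X : Type*}

/-- `X` with a half-open external collar `S × [0, ∞)` attached along `S`. -/
def openCollar (S : Set X) : Set (X × ℝ) := {p | p.2 = 0 ∨ p.1 ∈ S ∧ 0 ≤ p.2}

/-- `X` with an external collar `S × [0, 1]` attached along `S`. -/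
def closedCollar (S : Set X) : Set (X × ℝ) := {p | p.2 = 0 ∨ p.1 ∈ S ∧ 0 ≤ p.2 ∧ p.2 ≤ 1}

lemma openCollar.pos {S : Set X} {p : X × ℝ} (hp : p ∈ openCollar S) (h : p.2 ≠ 0) :
    p.1 ∈ S ∧ 0 < p.2 := by
  rcases hp with hp | ⟨hp, hp0⟩
  · exact absurd hp h
  · exact ⟨hp, lt_of_le_of_ne hp0 h.symm⟩

/-- The function `g` is a collar shift if translation by `g` along the external collar extends
to a homeomorphism of `openCollar S`. -/
def IsCollarShift [TopologicalSpace X] (S : Set X) (g : X → ℝ) : Prop :=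
  ∃ h : openCollar S ≃ₜ openCollar S, ∀ z : openCollar S, z.1.1 ∈ S →
    0 ≤ z.1.2 → (h z).1 = (z.1.1, z.1.2 + g z.1.1)

lemma IsCollarShift.zero [TopologicalSpace X] (S : Set X) : IsCollarShift S 0 :=
  ⟨.refl _, fun z _ _ => by simp⟩

lemma IsCollarShift.add [TopologicalSpace X] {S : Set X} {f g : X → ℝ} (hf : IsCollarShift S f)
    (hg : IsCollarShift S g) (hf0 : 0 ≤ f) : IsCollarShift S (f + g) := by
  obtain ⟨a, ha⟩ := hf
  obtain ⟨b, hb⟩ := hg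
  refine ⟨a.trans b, fun z hz h0 => ?_⟩
  have h1 := ha z hz h0
  have h2 := hb (a z) (by rw [h1]; exact hz) (by rw [h1]; exact add_nonneg h0 (hf0 _))
  rw [h1] at h2
  rw [Homeomorph.trans_apply, h2]
  simp [add_assoc]

lemma IsCollarShift.sum [TopologicalSpace X] {S : Set X} {ι : Type*} (s : Finset ι) {f : ι → X → ℝ}
    (hf : ∀ i ∈ s, IsCollarShift S (f i)) (hf0 : ∀ i ∈ s, 0 ≤ f i) :
    IsCollarShift S (∑ i ∈ s, f i) := by
  classical
  induction s using Finset.induction_on with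
  | empty => simpa using IsCollarShift.zero S
  | insert i s hi ih =>
    rw [Finset.sum_insert hi]
    exact (hf i (Finset.mem_insert_self _ _)).add
      (ih (fun j hj => hf j (Finset.mem_insert_of_mem hj))
        fun j hj => hf0 j (Finset.mem_insert_of_mem hj))
      (hf0 i (Finset.mem_insert_self _ _))

/-- The piecewise linear map that translates `(-∞, 0]` by `-a`, stretches `[0, 1]` and fixes
`[1, ∞)`. -/
def stretch (a s : ℝ) : ℝ := min s (max (s - a) ((1 + a) * s - a))

/-- The inverse of `stretch`. -/
def unstretch (a r : ℝ) : ℝ := max r (min (r + a) ((r + a) / (1 + a)))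

lemma stretch_of_nonpos {a s : ℝ} (ha : 0 ≤ a) (hs : s ≤ 0) : stretch a s = s - a := by
  rw [stretch, max_eq_left (by nlinarith), min_eq_right (by linarith)]

lemma stretch_of_one_le {a s : ℝ} (ha : 0 ≤ a) (hs : 1 ≤ s) : stretch a s = s := by
  rw [stretch, min_eq_left (le_max_of_le_right (by nlinarith))]

lemma stretch_zero (s : ℝ) : stretch 0 s = s := by simp [stretch]

lemma stretch_of_mem {a s : ℝ} (ha : 0 ≤ a) (h0 : 0 ≤ s) (h1 : s ≤ 1) :
    stretch a s = (1 + a) * s - a := by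
  rw [stretch, max_eq_right (by nlinarith), min_eq_right (by nlinarith)]

lemma unstretch_stretch {a : ℝ} (ha : 0 ≤ a) (s : ℝ) : unstretch a (stretch a s) = s := by
  have h1a : 0 < 1 + a := by linarith
  rcases le_total s 0 with h0 | h0
  · rw [stretch_of_nonpos ha h0, unstretch, sub_add_cancel,
      min_eq_left (by rw [le_div_iff₀ h1a]; nlinarith), max_eq_right (by linarith)]
  rcases le_total s 1 with h1 | h1
  · rw [stretch_of_mem ha h0 h1, unstretch, sub_add_cancel, mul_div_cancel_left₀ _ h1a.ne',
      min_eq_right (by nlinarith), max_eq_right (by nlinarith)]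
  · rw [stretch_of_one_le ha h1, unstretch, max_eq_left]
    exact min_le_of_right_le (by rw [div_le_iff₀ h1a]; nlinarith)

lemma stretch_unstretch {a : ℝ} (ha : 0 ≤ a) (r : ℝ) : stretch a (unstretch a r) = r := by
  have h1a : 0 < 1 + a := by linarith
  rcases le_total (r + a) 0 with h0 | h0
  · rw [unstretch, min_eq_left (by rw [le_div_iff₀ h1a]; nlinarith), max_eq_right (by linarith),
      stretch_of_nonpos ha h0, add_sub_cancel_right]
  rcases le_total r 1 with h1 | h1
  · rw [unstretch, min_eq_right (by rw [div_le_iff₀ h1a]; nlinarith),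
      max_eq_right (by rw [le_div_iff₀ h1a]; nlinarith),
      stretch_of_mem ha (div_nonneg h0 h1a.le) (by rw [div_le_one h1a]; linarith),
      mul_div_cancel₀ _ h1a.ne', add_sub_cancel_right]
  · rw [unstretch, max_eq_left, stretch_of_one_le ha h1]
    exact min_le_of_right_le (by rw [div_le_iff₀ h1a]; nlinarith)

/-- The fibrewise stretching of `ℝ × Y` by a function on `Y`. -/
def stretchHomeomorph {Y : Type*} [TopologicalSpace Y] {a : Y → ℝ} (ha : Continuous a)
    (ha0 : ∀ v, 0 ≤ a v) : ℝ × Y ≃ₜ ℝ × Y where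
  toFun q := (stretch (a q.2) q.1, q.2)
  invFun q := (unstretch (a q.2) q.1, q.2)
  left_inv q := by simp [unstretch_stretch (ha0 q.2)]
  right_inv q := by simp [stretch_unstretch (ha0 q.2)]
  continuous_toFun := by unfold stretch; fun_prop
  continuous_invFun := by
    have : ∀ q : ℝ × Y, 1 + a q.2 ≠ 0 := fun q => by linarith [ha0 q.2]
    unfold unstretch
    fun_prop (disch := assumption)

/-- A bump function supported in a half-space chart along `S` is a collar shift. -/
lemma isCollarShift_of_chart [TopologicalSpace X] [T2Space X] [CompactSpace X] {S : Set X} {Y : Type*}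
    [TopologicalSpace Y] {U : Set X} (hU : IsOpen U) (e : U ≃ₜ {p : ℝ × Y // 0 ≤ p.1})
    (he : ∀ y : U, (y : X) ∈ S ↔ (e y).1.1 = 0) {g : X → ℝ} (hg : Continuous g)
    (hg0 : ∀ x, 0 ≤ g x) (hgU : tsupport g ⊆ U) : IsCollarShift S g := by
  let toHalf : ℝ × Y → {p : ℝ × Y // 0 ≤ p.1} := fun q => ⟨(max q.1 0, q.2), le_max_right _ _⟩
  have toHalf_cont : Continuous toHalf := by unfold toHalf; fun_prop
  let q : ℝ × Y → U := fun w => e.symm (toHalf w)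
  have q_cont : Continuous q := e.symm.continuous.comp toHalf_cont
  have eq_q : ∀ w, (e (q w)).1 = (max w.1 0, w.2) := fun w => by simp [q, toHalf]
  have q_mem : ∀ w : ℝ × Y, w.1 ≤ 0 → (q w : X) ∈ S := fun w hw => by
    rw [he, eq_q]; exact max_eq_right hw
  let V : Set (openCollar S) := {z | z.1.1 ∈ U}
  have hV : IsOpen V := hU.preimage (by fun_prop)
  let c : ℝ × Y ≃ₜ V :=
    { toFun := fun w => ⟨⟨(q w, max (-w.1) 0), by
          rcases le_total w.1 0 with h | h
          · exact .inr ⟨q_mem w h, le_max_right _ _⟩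
          · exact .inl (max_eq_right (by linarith))⟩, (q w).2⟩
      invFun := fun z => ((e ⟨z.1.1.1, z.2⟩).1.1 - z.1.1.2, (e ⟨z.1.1.1, z.2⟩).1.2)
      left_inv := fun w => by
        simp only [Subtype.coe_eta, eq_q]
        ext
        · rcases le_total w.1 0 with h | h
          · rw [max_eq_right h, max_eq_left (by linarith)]; ring
          · rw [max_eq_left h, max_eq_right (by linarith)]; ring
        · rfl
      right_inv := by
        rintro ⟨⟨⟨x, t⟩, ht⟩, hx⟩
        have hx' : x ∈ U := hx
        have hnn := (e ⟨x, hx'⟩).2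
        have hq : q ((e ⟨x, hx'⟩).1.1 - t, (e ⟨x, hx'⟩).1.2) = ⟨x, hx'⟩ ∧
            max (-((e ⟨x, hx'⟩).1.1 - t)) 0 = t := by
          rw [e.symm_apply_eq]
          rcases ht with ht | ⟨hxS, ht⟩
          · have ht : t = 0 := ht
            subst ht
            refine ⟨Subtype.ext (Prod.ext ?_ rfl), ?_⟩
            · simpa [toHalf] using hnn
            · simpa using hnn
          · have h0 : (e ⟨x, hx'⟩).1.1 = 0 := (he ⟨x, hx'⟩).1 hxS
            have ht : 0 ≤ t := ht
            refine ⟨Subtype.ext (Prod.ext ?_ rfl), ?_⟩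
            · simpa [toHalf, h0] using ht
            · simpa [h0] using ht
        apply Subtype.ext
        apply Subtype.ext
        exact Prod.ext (congrArg Subtype.val hq.1) hq.2
      continuous_toFun := by fun_prop
      continuous_invFun := by fun_prop }
  let j : ℝ × Y → openCollar S := fun w => (c w).1
  have hj : IsOpenEmbedding j := hV.isOpenEmbedding_subtypeVal.comp c.isOpenEmbedding
  have hjr : ∀ z : openCollar S, z.1.1 ∈ U → ∃ w, c w = z := fun z hz =>
    ⟨c.symm ⟨z, hz⟩, by simp⟩
  let a : Y → ℝ := fun v => g (q (0, v))
  have ha : Continuous a := by unfold a; fun_prop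
  let L : Set Y := (fun y : U => (e y).1.2) '' (Subtype.val ⁻¹' tsupport g)
  have hL : IsCompact L := by
    have hcpt : IsCompact (Subtype.val ⁻¹' tsupport g : Set U) :=
      hU.isOpenEmbedding_subtypeVal.isInducing.isCompact_preimage'
        (isClosed_tsupport g).isCompact (by simpa using hgU)
    exact hcpt.image (by fun_prop)
  have haL : ∀ v ∉ L, a v = 0 := by
    intro v hv
    by_contra h
    refine hv ⟨q (0, v), subset_tsupport g h, ?_⟩
    simp [eq_q]
  let C : Set (ℝ × Y) := {w | w.1 ≤ 1 ∧ w.2 ∈ L}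
  have hC : IsClosed (j '' C) := by
    have hA : IsClosed ((fun w => (q w : X)) '' (Set.Icc (0 : ℝ) 1 ×ˢ L)) :=
      ((isCompact_Icc.prod hL).image (by fun_prop)).isClosed
    convert hA.preimage (show Continuous fun z : openCollar S => z.1.1 by fun_prop) using 1
    ext z
    constructor
    · rintro ⟨w, ⟨h1, h2⟩, rfl⟩
      refine ⟨(max w.1 0, w.2), ⟨⟨le_max_right _ _, max_le h1 zero_le_one⟩, h2⟩, ?_⟩
      change (q _ : X) = q w
      simp [q, toHalf]
    · rintro ⟨w, ⟨h1, h2⟩, hw⟩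
      have hw : (q w : X) = z.1.1 := hw
      have hz : z.1.1 ∈ U := hw ▸ (q w).2
      obtain ⟨u, rfl⟩ := hjr z hz
      have : q w = q u := Subtype.ext hw
      have h3 : (max w.1 0, w.2) = (max u.1 0, u.2) := by rw [← eq_q, ← eq_q, this]
      simp only [Prod.mk.injEq] at h3
      refine ⟨u, ⟨?_, h3.2 ▸ h2⟩, rfl⟩
      exact (le_max_left _ _).trans (h3.1 ▸ max_le h1.2 zero_le_one)
  obtain ⟨h, h1, h2⟩ := exists_homeomorph_extend hj
    (stretchHomeomorph ha fun v => hg0 _) hC (by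
      rintro ⟨s, v⟩ hw
      refine Prod.ext ?_ rfl
      change stretch (a v) s = s
      by_cases hv : v ∈ L
      · exact stretch_of_one_le (hg0 _) (le_of_not_ge fun hs => hw ⟨hs, hv⟩)
      · rw [haL v hv, stretch_zero])
  refine ⟨h, fun z hz ht => ?_⟩
  by_cases hzU : z.1.1 ∈ U
  · obtain ⟨⟨s, v⟩, hw⟩ := hjr z hzU
    have hw : j (s, v) = z := hw
    subst hw
    have hz' : (q (s, v) : X) ∈ S := hz
    rw [he, eq_q] at hz'
    have hs : s ≤ 0 := max_eq_right_iff.1 hz'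
    rw [h1]
    change ((q (stretch (a v) s, v) : X), max (-stretch (a v) s) 0)
      = ((q (s, v) : X), max (-s) 0 + g (q (s, v)))
    have hq : ∀ r ≤ 0, q (r, v) = q (0, v) := fun r hr => by
      simp [q, toHalf, max_eq_right hr]
    have ha0 : 0 ≤ a v := hg0 _
    rw [stretch_of_nonpos ha0 hs, hq s hs, hq _ (by linarith), max_eq_left (by linarith),
      max_eq_left (by linarith)]
    change _ = (_, -s + a v)
    congr 1
    ring
  · rw [h2 z (by rintro ⟨w, rfl⟩; exact hzU (c w).2)]
    have : g z.1.1 = 0 := by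
      by_contra hne
      exact hzU (hgU (subset_tsupport g hne))
    simp [this]

/-- A compact Hausdorff space, locally collared along a closed subset `S`, is unchanged by
attaching an external collar along `S`. -/
lemma exists_homeomorph_closedCollar [TopologicalSpace X] [T2Space X] [CompactSpace X] {S : Set X} (hS : IsClosed S)
    {Y : Type*} [TopologicalSpace Y]
    (hchart : ∀ x ∈ S, ∃ U : Set X, IsOpen U ∧ x ∈ U ∧ ∃ e : U ≃ₜ {p : ℝ × Y // 0 ≤ p.1},
      ∀ y : U, (y : X) ∈ S ↔ (e y).1.1 = 0) :
    ∃ d : X ≃ₜ closedCollar S, ∀ x, x ∈ S ↔ (d x).1.2 = 1 := by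
  have hshift : IsCollarShift S (1 : X → ℝ) := by
    choose! U hUo hxU e he using hchart
    obtain ⟨t, ht⟩ := hS.isCompact.elim_finite_subcover (fun x : S => U x)
      (fun x => hUo x x.2) (fun x hx => Set.mem_iUnion.2 ⟨⟨x, hx⟩, hxU x hx⟩)
    obtain ⟨f, hf1, hf2, hf3, -⟩ := exists_continuous_sum_one_of_isOpen_isCompact
      (s := fun i : Fin t.card => U (t.equivFin.symm i).1) (t := S)
      (fun i => hUo _ (t.equivFin.symm i).1.2) hS.isCompact (by
        intro x hx
        obtain ⟨i, hi, hxi⟩ := Set.mem_iUnion₂.1 (ht hx)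
        exact Set.mem_iUnion.2 ⟨t.equivFin ⟨i, hi⟩, by simpa using hxi⟩)
    have hsum := IsCollarShift.sum (S := S) Finset.univ (f := fun i => (f i : X → ℝ))
      (fun i _ => isCollarShift_of_chart (hUo _ (t.equivFin.symm i).1.2)
        (e _ (t.equivFin.symm i).1.2) (he _ (t.equivFin.symm i).1.2) (f i).continuous
        (fun x => (hf3 i x).1) (hf1 i)) (fun i _ x => (hf3 i x).1)
    obtain ⟨h, hh⟩ := hsum
    refine ⟨h, fun z hz h0 => ?_⟩
    rw [hh z hz h0]
    have := hf2 hz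
    simp at this
    simp [this]
  obtain ⟨h, hh⟩ := hshift
  have h_off : ∀ z : openCollar S, z.1.2 = 0 → (h z).1 ∈ closedCollar S := by
    intro z hz
    by_contra hcon
    have hmem := openCollar.pos (h z).2 fun h0 => hcon (.inl h0)
    have hcon' : (h z).1.1 ∈ S ∧ 1 < (h z).1.2 :=
      ⟨hmem.1, lt_of_not_ge fun h1 => hcon (.inr ⟨hmem.1, hmem.2.le, h1⟩)⟩
    let w : openCollar S := ⟨((h z).1.1, (h z).1.2 - 1), .inr ⟨hcon'.1, by simpa using hcon'.2.le⟩⟩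
    have hw : h w = h z := Subtype.ext (by
      rw [hh w hcon'.1 (by simpa [w] using hcon'.2.le)]
      simp [w])
    have := h.injective hw
    have h4 : (h z).1.2 - 1 = 0 :=
      (congrArg (fun u : openCollar S => u.1.2) this).trans hz
    linarith [hcon'.2]
  have h_on : ∀ z : openCollar S, z.1 ∈ closedCollar S → (h.symm z).1.2 = 0 := by
    intro z hz
    by_contra hcon
    have hm' := openCollar.pos (h.symm z).2 hcon
    have := hh _ hm'.1 hm'.2.le
    rw [h.apply_symm_apply] at this
    rw [this] at hz
    have h1 : (h.symm z).1.2 + 1 = 0 ∨ (h.symm z).1.2 + 1 ≤ 1 := hz.imp_right fun h => h.2.2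
    rcases h1 with h1 | h1 <;> linarith [hm'.2]
  have sub : closedCollar S ⊆ openCollar S := fun z hz => hz.imp_right fun h => ⟨h.1, h.2.1⟩
  let d : X ≃ₜ closedCollar S :=
    { toFun := fun x => ⟨(h ⟨(x, 0), .inl rfl⟩).1, h_off _ rfl⟩
      invFun := fun z => (h.symm ⟨z.1, sub z.2⟩).1.1
      left_inv := fun x => by simp
      right_inv := fun z => by
        have h0 := h_on ⟨z.1, sub z.2⟩ z.2
        have : (⟨((h.symm ⟨z.1, sub z.2⟩).1.1, 0), .inl rfl⟩ : openCollar S)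
            = h.symm ⟨z.1, sub z.2⟩ := Subtype.ext (Prod.ext rfl h0.symm)
        apply Subtype.ext
        change (h _).1 = _
        rw [this]
        simp
      continuous_toFun := by fun_prop
      continuous_invFun := by fun_prop }
  refine ⟨d, fun x => ⟨fun hx => ?_, fun hx => ?_⟩⟩
  · change (h _).1.2 = 1
    rw [hh _ hx le_rfl]
    simp
  · have hx : (h ⟨(x, 0), .inl rfl⟩).1.2 = 1 := hx
    have hS' : (h ⟨(x, 0), .inl rfl⟩).1.1 ∈ S :=
      (openCollar.pos (h ⟨(x, 0), .inl rfl⟩).2 (by rw [hx]; exact one_ne_zero)).1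
    let w : openCollar S := ⟨((h ⟨(x, 0), .inl rfl⟩).1.1, 0), .inl rfl⟩
    have hw : h w = h ⟨(x, 0), .inl rfl⟩ := Subtype.ext (by
      rw [hh w hS' le_rfl]
      exact Prod.ext rfl (by simp [w, hx]))
    have hwx : (h ⟨(x, 0), .inl rfl⟩).1.1 = x :=
      congrArg (fun u : openCollar S => u.1.1) (h.injective hw)
    rwa [hwx] at hS'

end Collar

section HalfSpace

variable {E Y X : Type*} [NormedAddCommGroup Y] [NormedSpace ℝ Y]

/-- A half-space contains arbitrarily small open copies of itself around each point of its
bounding hyperplane. -/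
lemma exists_isOpenEmbedding_halfSpace {p : {p : ℝ × Y // 0 ≤ p.1}} (hp : p.1.1 = 0)
    {O : Set {p : ℝ × Y // 0 ≤ p.1}} (hO : O ∈ 𝓝 p) :
    ∃ s : {p : ℝ × Y // 0 ≤ p.1} → {p : ℝ × Y // 0 ≤ p.1},
      IsOpenEmbedding s ∧ s ⟨0, le_rfl⟩ = p ∧ Set.range s ⊆ O := by
  obtain ⟨ε, hε, hεO⟩ := Metric.mem_nhds_iff.1 hO
  let a : ℝ × Y ≃ₜ ℝ × Y :=
    (Homeomorph.smulOfNeZero ε hε.ne').trans (Homeomorph.addLeft p.1)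
  let β : ℝ × Y → ℝ × Y := a ∘ OpenPartialHomeomorph.univUnitBall
  have hβ : IsOpenEmbedding β :=
    a.isOpenEmbedding.comp (OpenPartialHomeomorph.univUnitBall.isOpenEmbedding rfl)
  have hβ_apply : ∀ x, β x = p.1 + ε • ((√(1 + ‖x‖ ^ 2))⁻¹ • x) := fun x => rfl
  have hβ1 : ∀ x, (β x).1 = ε * (√(1 + ‖x‖ ^ 2))⁻¹ * x.1 := fun x => by
    rw [hβ_apply]
    simp [hp, mul_assoc]
  have hpos : ∀ x : ℝ × Y, 0 < ε * (√(1 + ‖x‖ ^ 2))⁻¹ := fun x => by positivity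
  have hnn : ∀ x : ℝ × Y, 0 ≤ (β x).1 ↔ 0 ≤ x.1 := fun x => by
    rw [hβ1, mul_nonneg_iff_of_pos_left (hpos x)]
  have hball : ∀ x, dist (β x) p.1 < ε := fun x => by
    have h1 := OpenPartialHomeomorph.univUnitBall.map_source (Set.mem_univ x)
    have h1 : ‖OpenPartialHomeomorph.univUnitBall x‖ < 1 := mem_ball_zero_iff.1 h1
    have h2 : β x - p.1 = ε • OpenPartialHomeomorph.univUnitBall x := by
      simp [β, a]
    rw [dist_eq_norm, h2, norm_smul, Real.norm_of_nonneg hε.le]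
    nlinarith
  let s : {p : ℝ × Y // 0 ≤ p.1} → {p : ℝ × Y // 0 ≤ p.1} :=
    fun x => ⟨β x.1, (hnn _).2 x.2⟩
  have hs : Continuous s := by
    have := hβ.continuous
    fun_prop
  refine ⟨s, ⟨.of_comp hs continuous_subtype_val (hβ.isEmbedding.comp .subtypeVal), ?_⟩,
    Subtype.ext (by simp [s, hβ_apply]), ?_⟩
  · convert hβ.isOpen_range.preimage
      (continuous_subtype_val : Continuous fun x : {p : ℝ × Y // 0 ≤ p.1} => x.1) using 1
    ext y
    constructor
    · rintro ⟨x, rfl⟩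
      exact ⟨x.1, rfl⟩
    · rintro ⟨x, hx⟩
      exact ⟨⟨x, (hnn x).1 (hx ▸ y.2)⟩, Subtype.ext hx⟩
  · rintro _ ⟨x, rfl⟩
    exact hεO (hball x.1)

/-- The interior of a half-space is an open copy of the whole space. -/
lemma exists_isOpenEmbedding_halfSpace_interior {Y : Type*} [NormedAddCommGroup Y] :
    ∃ s : ℝ × Y → {p : ℝ × Y // 0 ≤ p.1}, IsOpenEmbedding s ∧
      ∀ p : {p : ℝ × Y // 0 ≤ p.1}, 0 < p.1.1 → p ∈ Set.range s := by
  have hexp : IsOpenEmbedding (Prod.map Real.exp id : ℝ × Y → ℝ × Y) :=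
    Real.isOpenEmbedding_exp.prodMap .id
  let s : ℝ × Y → {p : ℝ × Y // 0 ≤ p.1} := fun x => ⟨(Real.exp x.1, x.2), (Real.exp_pos _).le⟩
  have hs : Continuous s := by unfold s; fun_prop
  have hrange : Set.range s = {p | 0 < p.1.1} := by
    ext p
    constructor
    · rintro ⟨x, rfl⟩
      exact Real.exp_pos _
    · intro hp
      exact ⟨(Real.log p.1.1, p.1.2), Subtype.ext (Prod.ext (Real.exp_log hp) rfl)⟩
  refine ⟨s, ⟨.of_comp hs continuous_subtype_val hexp.isEmbedding, ?_⟩,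
    fun p hp => hrange ▸ hp⟩
  rw [hrange]
  exact isOpen_lt continuous_const (by fun_prop)

/-- If some point has both a half-space chart centred at it and a Euclidean neighbourhood, then
every point with a Euclidean neighbourhood has a half-space chart centred at it. -/
lemma exists_halfSpace_chart_of_isOpenEmbedding [NormedAddCommGroup E] [TopologicalSpace X]
    {U : Set X} (hU : IsOpen U) (e : U ≃ₜ {p : ℝ × Y // 0 ≤ p.1}) {y : X} (hy : y ∈ U)
    (hey : (e ⟨y, hy⟩).1.1 = 0) {i : E → X} (hi : IsOpenEmbedding i) (hyi : y ∈ Set.range i)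
    {i' : E → X} (hi' : IsOpenEmbedding i') {z : X} (hz : z ∈ Set.range i') :
    ∃ V : Set X, IsOpen V ∧ ∃ hz : z ∈ V, ∃ e' : V ≃ₜ {p : ℝ × Y // 0 ≤ p.1},
      (e' ⟨z, hz⟩).1.1 = 0 := by
  have hg : IsOpenEmbedding (fun p => (e.symm p : X)) :=
    hU.isOpenEmbedding_subtypeVal.comp e.symm.isOpenEmbedding
  have hgy : (e.symm (e ⟨y, hy⟩) : X) = y := by simp
  obtain ⟨s, hs, hs0, hsr⟩ := exists_isOpenEmbedding_halfSpace hey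
    (hg.continuous.continuousAt.preimage_mem_nhds
      (hi.isOpen_range.mem_nhds (by rwa [hgy])))
  choose m hm using fun x => hsr (Set.mem_range_self x)
  have hmo : IsOpenEmbedding m := by
    refine hi.of_comp m ?_
    have : i ∘ m = (fun p => (e.symm p : X)) ∘ s := funext hm
    rw [this]
    exact hg.comp hs
  obtain ⟨u, rfl⟩ := hz
  have hF : IsOpenEmbedding (i' ∘ Homeomorph.addLeft (u - m ⟨0, le_rfl⟩) ∘ m) :=
    hi'.comp ((Homeomorph.isOpenEmbedding _).comp hmo)
  have hF0 : (i' ∘ Homeomorph.addLeft (u - m ⟨0, le_rfl⟩) ∘ m) ⟨0, le_rfl⟩ = i' u := by simp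
  refine ⟨_, hF.isOpen_range, ⟨_, hF0⟩, hF.isEmbedding.toHomeomorph.symm, ?_⟩
  have : hF.isEmbedding.toHomeomorph.symm ⟨i' u, ⟨_, hF0⟩⟩ = ⟨0, le_rfl⟩ := by
    rw [Homeomorph.symm_apply_eq]
    exact Subtype.ext hF0.symm
  rw [this]
  rfl

end HalfSpace

/-- A compact Hausdorff space with an external collar along a sphere whose complement is an open
cell is a closed ball. -/
lemma nonempty_homeomorph_closedBall {E : Type*} [NormedAddCommGroup E] [NormedSpace ℝ E]
    [ProperSpace E] {X : Type*} [TopologicalSpace X] [T2Space X] [CompactSpace X] {S : Set X}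
    (d : X ≃ₜ closedCollar S) (hd : ∀ x, x ∈ S ↔ (d x).1.2 = 1)
    (φ : S ≃ₜ Metric.sphere (0 : E) 1) {i : E → X} (hi : IsOpenEmbedding i)
    (hir : Set.range i = Sᶜ) : Nonempty (X ≃ₜ Metric.closedBall (0 : E) 1) := by
  let τ : X → ℝ := fun x => (d x).1.2
  have hτ : Continuous τ := by unfold τ; fun_prop
  have hτ0 : ∀ x, 0 ≤ τ x := fun x => (d x).2.elim (fun h => h.ge) fun h => h.2.1
  have hτ1 : ∀ x, τ x ≤ 1 := fun x => (d x).2.elim (fun h => h.trans_le zero_le_one) fun h => h.2.2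
  have hτS : ∀ x, 0 < τ x → (d x).1.1 ∈ S := fun x hx =>
    (d x).2.elim (fun h => absurd h hx.ne') fun h => h.1
  have hcell : ∀ ε : ℝ, 0 < ε → ε ≤ 1 →
      ∃ j : E → X, IsOpenEmbedding j ∧ Set.range j = {x | τ x < ε} := by
    intro ε hε hε1
    let G : X → X := fun x => d.symm ⟨((d x).1.1, ε * (d x).1.2),
      (d x).2.imp (fun h => by simp [h]) fun h =>
        ⟨h.1, mul_nonneg hε.le h.2.1, mul_le_one₀ hε1 h.2.1 h.2.2⟩⟩
    have hG : Continuous G := by unfold G; fun_prop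
    have hdG : ∀ x, (d (G x)).1 = ((d x).1.1, ε * (d x).1.2) := fun x => by simp [G]
    have hGinj : Function.Injective G := by
      intro x y hxy
      have h1 : (d (G x)).1 = (d (G y)).1 := by rw [hxy]
      rw [hdG, hdG, Prod.mk.injEq, mul_right_inj' hε.ne'] at h1
      exact d.injective (Subtype.ext (Prod.ext h1.1 h1.2))
    have hrange : Set.range (G ∘ i) = {x | τ x < ε} := by
      rw [Set.range_comp, hir]
      ext y
      constructor
      · rintro ⟨x, hx, rfl⟩
        have hx1 : τ x < 1 := lt_of_le_of_ne (hτ1 x) fun h => hx ((hd x).2 h)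
        change (d (G x)).1.2 < ε
        rw [hdG]
        exact mul_lt_of_lt_one_right hε hx1
      · intro hy
        have hy : τ y < ε := hy
        have hy1 : τ y / ε < 1 := (div_lt_one hε).2 hy
        let x : X := d.symm ⟨((d y).1.1, τ y / ε), (d y).2.imp
          (fun h => by simp [τ, h]) fun h => ⟨h.1, div_nonneg (hτ0 y) hε.le, hy1.le⟩⟩
        have hdx : (d x).1 = ((d y).1.1, τ y / ε) := by simp [x]
        refine ⟨x, fun hx => ?_, d.injective (Subtype.ext ?_)⟩
        · rw [hd, hdx] at hx
          exact hy1.ne hx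
        · rw [hdG, hdx]
          exact Prod.ext rfl (mul_div_cancel₀ _ hε.ne')
    refine ⟨G ∘ i, ⟨(hG.isClosedEmbedding hGinj).isEmbedding.comp hi.isEmbedding, ?_⟩, hrange⟩
    rw [hrange]
    exact isOpen_lt hτ continuous_const
  let p : X := d.symm ⟨(i 0, 0), .inl rfl⟩
  have hp : τ p = 0 := by simp [τ, p]
  obtain ⟨f, hf, hfr⟩ := exists_isOpenEmbedding_compl_singleton hτ hp hcell
  let b : Metric.closedBall (0 : E) 1 := ⟨0, by simp⟩
  have hnorm : ∀ x : {x : X // 0 < τ x},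
      ‖τ x • (φ ⟨(d x).1.1, hτS x x.2⟩ : E)‖ = τ x := fun x => by
    rw [norm_smul, mem_sphere_zero_iff_norm.1 (φ _).2, mul_one, Real.norm_of_nonneg (hτ0 _)]
  have hz0 : ∀ z : {z : Metric.closedBall (0 : E) 1 // z ≠ b}, (z.1 : E) ≠ 0 :=
    fun z h => z.2 (Subtype.ext h)
  have hz1 : ∀ z : {z : Metric.closedBall (0 : E) 1 // z ≠ b},
      ‖(z.1 : E)‖⁻¹ • (z.1 : E) ∈ Metric.sphere (0 : E) 1 := fun z => by
    rw [mem_sphere_zero_iff_norm, norm_smul, norm_inv, norm_norm,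
      inv_mul_cancel₀ (norm_ne_zero_iff.2 (hz0 z))]
  let r : {z : Metric.closedBall (0 : E) 1 // z ≠ b} → X := fun z =>
    d.symm ⟨((φ.symm ⟨_, hz1 z⟩).1, ‖(z.1 : E)‖),
      .inr ⟨(φ.symm _).2, norm_nonneg _, mem_closedBall_zero_iff.1 z.1.2⟩⟩
  have hdr : ∀ z, (d (r z)).1 = ((φ.symm ⟨_, hz1 z⟩).1, ‖(z.1 : E)‖) := fun z => by simp [r]
  have hτr : ∀ z, τ (r z) = ‖(z.1 : E)‖ := fun z => congrArg Prod.snd (hdr z)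
  let polar : {x : X // 0 < τ x} ≃ₜ {z : Metric.closedBall (0 : E) 1 // z ≠ b} :=
    { toFun := fun x => ⟨⟨τ x • (φ ⟨(d x).1.1, hτS x x.2⟩ : E), by
          rw [mem_closedBall_zero_iff, hnorm]; exact hτ1 x⟩, fun h => by
          have h0 : τ x • (φ ⟨(d x).1.1, hτS x x.2⟩ : E) = 0 := congrArg Subtype.val h
          have := hnorm x
          rw [h0, norm_zero] at this
          exact x.2.ne this⟩
      invFun := fun z => ⟨r z, by rw [hτr]; exact norm_pos_iff.2 (hz0 z)⟩
      left_inv := fun x => by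
        apply Subtype.ext
        apply d.injective
        apply Subtype.ext
        rw [hdr]
        refine Prod.ext ?_ (hnorm x)
        change (φ.symm _ : X) = (⟨(d x).1.1, hτS x x.2⟩ : S)
        congr 1
        rw [φ.symm_apply_eq]
        apply Subtype.ext
        change ‖τ x • (φ ⟨(d x).1.1, hτS x x.2⟩ : E)‖⁻¹ • _ = _
        rw [hnorm, smul_smul, inv_mul_cancel₀ x.2.ne', one_smul]
      right_inv := fun z => by
        apply Subtype.ext
        apply Subtype.ext
        change τ (r z) • (φ ⟨(d (r z)).1.1, _⟩ : E) = z.1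
        have : (⟨(d (r z)).1.1, hτS (r z) (by rw [hτr]; exact norm_pos_iff.2 (hz0 z))⟩ : S)
            = φ.symm ⟨_, hz1 z⟩ := Subtype.ext (congrArg Prod.fst (hdr z))
        rw [this, φ.apply_symm_apply, hτr, smul_smul,
          mul_inv_cancel₀ (norm_ne_zero_iff.2 (hz0 z)), one_smul]
      continuous_toFun := by fun_prop
      continuous_invFun := by
        have h0 : ∀ z : {z : Metric.closedBall (0 : E) 1 // z ≠ b}, ‖(z.1 : E)‖ ≠ 0 :=
          fun z => norm_ne_zero_iff.2 (hz0 z)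
        unfold r
        fun_prop (disch := assumption) }
  have := isCompact_iff_compactSpace.1 (isCompact_closedBall (0 : E) 1)
  have hpolar : Set.range (fun x => (polar x).1) = {b}ᶜ := by
    ext z
    constructor
    · rintro ⟨x, rfl⟩
      exact (polar x).2
    · intro hz
      exact ⟨polar.symm ⟨z, hz⟩, by simp⟩
  exact ⟨(OnePoint.equivOfIsEmbeddingOfRangeEq p f hf.isEmbedding hfr).symm.trans
    (OnePoint.equivOfIsEmbeddingOfRangeEq b (fun x => (polar x).1)
      (Topology.IsEmbedding.subtypeVal.comp polar.isEmbedding) hpolar)⟩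

end BallRecognition

/-- **Generalized Poincaré conjecture + Brown's collar theorem** (Bao–He, Theorem
`thm:poincare`): a compact `n`-dimensional topological manifold with boundary whose
boundary is an `(n−1)`-sphere and whose interior is an open `n`-ball is homeomorphic
to a closed `n`-ball. -/
theorem statement_9
    (n : ℕ) (X : Type) [TopologicalSpace X] [T2Space X] [CompactSpace X]
    (bdry : Set X)
    -- `X` is an `n`-manifold with boundary: every point has an open neighborhood
    -- homeomorphic to `ℝⁿ` or to `ℝ_{≥0} × ℝ^{n−1}`, the point mapping into
    -- `{0} × ℝ^{n−1}` in the second case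
    (hchart : ∀ x : X,
      (∃ U : Set X, IsOpen U ∧ x ∈ U ∧
        Nonempty (↥U ≃ₜ EuclideanSpace ℝ (Fin n))) ∨
      (∃ U : Set X, IsOpen U ∧ ∃ hx : x ∈ U,
        ∃ e : ↥U ≃ₜ {p : ℝ × EuclideanSpace ℝ (Fin (n - 1)) // 0 ≤ p.1},
          (e ⟨x, hx⟩).1.1 = 0))
    -- `∂X` is the set of boundary points
    (hbdry : bdry = {x : X | ∃ U : Set X, IsOpen U ∧ ∃ hx : x ∈ U,
      ∃ e : ↥U ≃ₜ {p : ℝ × EuclideanSpace ℝ (Fin (n - 1)) // 0 ≤ p.1},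
        (e ⟨x, hx⟩).1.1 = 0})
    -- `∂X` is an `(n−1)`-sphere
    (hsph : Nonempty (↥bdry ≃ₜ ↥(Metric.sphere (0 : EuclideanSpace ℝ (Fin n)) 1)))
    -- `X ∖ ∂X` is an open `n`-ball
    (hint : Nonempty (↥(bdryᶜ) ≃ₜ ↥(Metric.ball (0 : EuclideanSpace ℝ (Fin n)) 1))) :
    Nonempty (X ≃ₜ ↥(Metric.closedBall (0 : EuclideanSpace ℝ (Fin n)) 1)) := by
  rcases n.eq_zero_or_pos with rfl | hn
  · have hempty : bdry = ∅ := by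
      obtain ⟨φ⟩ := hsph
      refine Set.eq_empty_of_forall_notMem fun x hx => ?_
      have := mem_sphere_zero_iff_norm.1 (φ ⟨x, hx⟩).2
      rw [Subsingleton.elim (φ ⟨x, hx⟩ : EuclideanSpace ℝ (Fin 0)) 0, norm_zero] at this
      exact zero_ne_one this
    obtain ⟨ψ⟩ := hint
    have h1 : bdryᶜ = Set.univ := by rw [hempty, Set.compl_empty]
    have h2 : Metric.ball (0 : EuclideanSpace ℝ (Fin 0)) 1 = Metric.closedBall 0 1 := by
      ext x
      simp [Subsingleton.elim x 0]
    exact ⟨(Homeomorph.Set.univ X).symm.trans <| (Homeomorph.setCongr h1.symm).trans <|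
      ψ.trans <| Homeomorph.setCongr h2⟩
  obtain ⟨φ⟩ := hsph
  obtain ⟨ψ⟩ := hint
  have hclosed : IsClosed bdry := by
    have := isCompact_iff_compactSpace.1 (isCompact_sphere (0 : EuclideanSpace ℝ (Fin n)) 1)
    exact (isCompact_iff_compactSpace.2 φ.symm.compactSpace).isClosed
  let c : EuclideanSpace ℝ (Fin n) ≃ₜ ↥(bdryᶜ) := Homeomorph.unitBall.trans ψ.symm
  let i : EuclideanSpace ℝ (Fin n) → X := fun v => c v
  have hi : IsOpenEmbedding i :=
    hclosed.isOpen_compl.isOpenEmbedding_subtypeVal.comp c.isOpenEmbedding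
  have hir : Set.range i = bdryᶜ := by
    change Set.range (Subtype.val ∘ c) = _
    rw [c.surjective.range_comp, Subtype.range_coe]
  have hdim : Module.finrank ℝ (EuclideanSpace ℝ (Fin n))
      = Module.finrank ℝ (ℝ × EuclideanSpace ℝ (Fin (n - 1))) := by
    simp
    omega
  let L := ContinuousLinearEquiv.ofFinrankEq hdim
  obtain ⟨s, hs, hsr⟩ :=
    exists_isOpenEmbedding_halfSpace_interior (Y := EuclideanSpace ℝ (Fin (n - 1)))
  obtain ⟨d, hd⟩ := exists_homeomorph_closedCollar hclosed
    (Y := EuclideanSpace ℝ (Fin (n - 1))) (by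
      intro x hx
      rw [hbdry] at hx
      obtain ⟨U, hU, hxU, e, -⟩ := hx
      refine ⟨U, hU, hxU, e, fun y => ⟨fun hy => ?_, fun hy => ?_⟩⟩
      · by_contra hne
        have hpos : 0 < (e y).1.1 := lt_of_le_of_ne (e y).2 (Ne.symm hne)
        obtain ⟨w, hw⟩ := hsr _ hpos
        rw [hbdry] at hy
        obtain ⟨V, hV, hyV, e', he'⟩ := hy
        have hj : IsOpenEmbedding (fun v => (e.symm (s (L v)) : X)) :=
          hU.isOpenEmbedding_subtypeVal.comp <| e.symm.isOpenEmbedding.comp <|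
            hs.comp L.toHomeomorph.isOpenEmbedding
        have hz : i 0 ∈ bdry := by
          rw [hbdry]
          exact exists_halfSpace_chart_of_isOpenEmbedding hV e' hyV he' hj
            ⟨L.symm w, by simp [hw]⟩ hi ⟨0, rfl⟩
        exact (c 0).2 hz
      · rw [hbdry]
        exact ⟨U, hU, y.2, e, hy⟩)
  exact nonempty_homeomorph_closedBall d hd φ hi hir

end TotPos
end
end

section
/- Let W be the Weyl group of a Kac–Moody group and s̲ = (s_{i_1},…,s_{i_n}) a sequence of simple reflections, with w = m_∗(s̲). Then the augmented face poset Q̂_{w,s̲} = {(w, s̲') : s̲' ∈ Wⁿ, s̲' ≤ s̲ componentwise, m_∗(s̲') = w} ⊔ {0̂} (with 0̂ the added minimum, and (w, s̲'') ≤ (w, s̲') iff s̲'' ≤ s̲') is graded, thin, and shellable. -/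
open Pointwise Topology

noncomputable section

namespace TotPos

/-- the augmented face poset `Q̂_{w,s̲}` of the braid variety: subwords `s̲' ≤ s̲` with
`m_∗(s̲') = m_∗(s̲) = w`, ordered componentwise, with an added minimum `0̂ = none` -/
def QhatBraid {B W : Type} [Group W] {M : CoxeterMatrix B}
    (cs : CoxeterSystem M W) (dem : W → W → W) {n : ℕ} (s : Fin n → B)
    (a b : Option {s' : Fin n → W //
      seqLE cs s' (fun i => cs.simple (s i)) ∧
      demProd dem s' = demProd dem fun i => cs.simple (s i)}) : Prop :=
  match a, b with
  | none, _ => True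
  | some _, none => False
  | some p, some q => seqLE cs p.1 q.1

/-! ### Half-spaces and the comparison of `ℓ (s u)` with `ℓ (s r u)` -/

section HalfSpace

variable {B W : Type} [Group W] {M : CoxeterMatrix B} {cs : CoxeterSystem M W}
  {dem : W → W → W}

theorem IsDemazure.one_left (hdem : IsDemazure cs dem) (w : W) : dem 1 w = w := by
  simpa using hdem.eq_mul 1 w (by simp)

/-- Left multiplication by a simple reflection in the Demazure monoid. -/
theorem IsDemazure.simple_left (hdem : IsDemazure cs dem) (i : B) (w : W) :
    (dem (cs.simple i) w = cs.simple i * w ∧ cs.length (cs.simple i * w) = cs.length w + 1) ∨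
    (dem (cs.simple i) w = w ∧ cs.length (cs.simple i * w) + 1 = cs.length w) := by
  rcases cs.length_simple_mul w i with h | h
  · exact Or.inl ⟨hdem.eq_mul _ _ (by rw [h, cs.length_simple, add_comm]), h⟩
  · exact Or.inr ⟨hdem.absorb i w (by omega), h⟩

theorem IsDemazure.simple_right_absorb (hdem : IsDemazure cs dem) (i : B) (w : W)
    (h : cs.length (w * cs.simple i) < cs.length w) : dem w (cs.simple i) = w := by
  have h1 : cs.length (w * cs.simple i) + 1 = cs.length w := by
    rcases cs.length_mul_simple w i with h' | h' <;> omega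
  have h2 : dem (w * cs.simple i) (cs.simple i) = w := by
    rw [hdem.eq_mul] <;> simp [h1]
  have h3 : dem (cs.simple i) (cs.simple i) = cs.simple i :=
    hdem.absorb i _ (by simp)
  calc dem w (cs.simple i) = dem (dem (w * cs.simple i) (cs.simple i)) (cs.simple i) := by rw [h2]
    _ = w := by rw [hdem.assoc, h3, h2]

/-- The folding condition, a consequence of the associativity of the Demazure product. -/
theorem IsDemazure.folding (hdem : IsDemazure cs dem) (i j : B) (w : W)
    (h1 : cs.length w < cs.length (cs.simple i * w))
    (h2 : cs.length (cs.simple i * (w * cs.simple j)) < cs.length (w * cs.simple j)) :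
    cs.simple i * w = w * cs.simple j := by
  have a := cs.length_simple_mul w i
  have b := cs.length_mul_simple w j
  have c := cs.length_simple_mul (w * cs.simple j) i
  have d := cs.length_mul_simple (cs.simple i * w) j
  rw [mul_assoc] at d
  have e1 : dem w (cs.simple j) = w * cs.simple j :=
    hdem.eq_mul _ _ (by rw [cs.length_simple]; omega)
  have e2 : dem (cs.simple i) w = cs.simple i * w :=
    hdem.eq_mul _ _ (by rw [cs.length_simple]; omega)
  have e3 := hdem.assoc (cs.simple i) w (cs.simple j)
  rw [e1, e2, hdem.absorb i _ h2, hdem.simple_right_absorb] at e3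
  · exact e3
  · rw [mul_assoc]; omega

/-- `X` is one of the two half-spaces bounded by the wall of the reflection `r`. -/
structure IsHalfSpace (cs : CoxeterSystem M W) (r : W) (X : Set W) : Prop where
  mem_iff : ∀ u, u ∈ X ↔ r * u ∉ X
  cross : ∀ u i, u ∈ X → u * cs.simple i ∉ X → r * u = u * cs.simple i

theorem IsDemazure.isHalfSpace_simple (hdem : IsDemazure cs dem) (i : B) :
    IsHalfSpace cs (cs.simple i) {u | cs.length u < cs.length (cs.simple i * u)} where
  mem_iff u := by
    have := cs.length_simple_mul u i
    simp only [Set.mem_ofPred_eq, cs.simple_mul_simple_cancel_left]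
    omega
  cross u j hu hj := by
    have := cs.length_simple_mul (u * cs.simple j) i
    simp only [Set.mem_ofPred_eq] at hu hj
    exact hdem.folding i j u hu (by omega)

theorem IsHalfSpace.translate {r : W} {X : Set W} (h : IsHalfSpace cs r X) (x : W) :
    IsHalfSpace cs (x * r * x⁻¹) {u | x⁻¹ * u ∈ X} where
  mem_iff u := by
    have := h.mem_iff (x⁻¹ * u)
    simpa [mul_assoc] using this
  cross u j hu hj := by
    have := h.cross (x⁻¹ * u) j hu (by simpa [mul_assoc] using hj)
    have := congrArg (x * ·) this
    simpa [mul_assoc] using this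

theorem IsHalfSpace.compl {r : W} {X : Set W} (h : IsHalfSpace cs r X) (hr : r * r = 1) :
    IsHalfSpace cs r Xᶜ where
  mem_iff u := by
    have := h.mem_iff u
    simp only [Set.mem_compl_iff]
    tauto
  cross u j hu hj := by
    have h1 := h.cross (u * cs.simple j) j (by simpa using hj) (by simpa using hu)
    have h2 := congrArg (r * ·) h1
    simp only [← mul_assoc, hr, one_mul] at h2
    simpa using h2.symm

theorem IsDemazure.exists_isHalfSpace (hdem : IsDemazure cs dem) {r : W}
    (hr : cs.IsReflection r) : ∃ X, IsHalfSpace cs r X ∧ 1 ∈ X := by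
  have hrr := hr.mul_self
  obtain ⟨x, i, rfl⟩ := hr
  have h := (hdem.isHalfSpace_simple i).translate x
  by_cases h1 : (1 : W) ∈ {u | x⁻¹ * u ∈ {u | cs.length u < cs.length (cs.simple i * u)}}
  · exact ⟨_, h, h1⟩
  · exact ⟨_, h.compl hrr, h1⟩

theorem IsHalfSpace.length_lt_of_notMem {r : W} {X : Set W} (h : IsHalfSpace cs r X)
    (hr : r * r = 1) (h1 : 1 ∈ X) {u : W} (hu : u ∉ X) :
    cs.length (r * u) < cs.length u := by
  have key : ∀ ω : List B, cs.wordProd ω ∉ X →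
      ∃ ω' : List B, ω'.length < ω.length ∧ cs.wordProd ω' = r * cs.wordProd ω := by
    intro ω
    induction ω using List.reverseRecOn with
    | nil => intro h; simp [h1] at h
    | append_singleton ω i ih =>
      intro hω
      rw [cs.wordProd_append, cs.wordProd_singleton] at hω
      by_cases hm : cs.wordProd ω ∈ X
      · refine ⟨ω, by simp, ?_⟩
        rw [cs.wordProd_append, cs.wordProd_singleton, ← h.cross _ _ hm hω, ← mul_assoc, hr,
          one_mul]
      · obtain ⟨ω', h2, h3⟩ := ih hm
        refine ⟨ω' ++ [i], by simpa using h2, ?_⟩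
        rw [cs.wordProd_append, cs.wordProd_append, h3, mul_assoc]
  obtain ⟨ω, hω, rfl⟩ := cs.exists_isReduced u
  obtain ⟨ω', h2, h3⟩ := key ω hu
  rw [← h3, hω.eq]
  exact (cs.length_wordProd_le ω').trans_lt h2

theorem IsHalfSpace.mem_iff_length_lt {r : W} {X : Set W} (h : IsHalfSpace cs r X)
    (hr : r * r = 1) (h1 : 1 ∈ X) (u : W) : u ∈ X ↔ cs.length u < cs.length (r * u) := by
  constructor
  · intro hu
    have := h.length_lt_of_notMem hr h1 ((h.mem_iff u).1 hu)
    rwa [← mul_assoc, hr, one_mul] at this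
  · intro hlt
    by_contra hu
    have := h.length_lt_of_notMem hr h1 hu
    omega

theorem IsDemazure.length_simple_mul_lt (hdem : IsDemazure cs dem) {r : W}
    (hr : cs.IsReflection r) {i : B} (hri : r ≠ cs.simple i) {u : W}
    (hu : cs.length u < cs.length (r * u)) :
    cs.length (cs.simple i * u) < cs.length (cs.simple i * (r * u)) := by
  obtain ⟨X, hX, h1⟩ := hdem.exists_isHalfSpace hr
  have hi : cs.simple i ∈ X := by
    by_contra hi
    have := hX.cross 1 i h1 (by simpa using hi)
    simp at this
    exact hri this
  have hY := hX.translate (cs.simple i)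
  have hrr := (hr.conj (cs.simple i)).mul_self
  have := (hY.mem_iff_length_lt hrr (by simpa using hi) (cs.simple i * u)).1
    (by simpa using (hX.mem_iff_length_lt hr.mul_self h1 u).2 hu)
  simpa [mul_assoc] using this

end HalfSpace

/-! ### Demazure products of subwords -/

section Subwords

variable {B W : Type} [Group W] {M : CoxeterMatrix B} {cs : CoxeterSystem M W}
  {dem : W → W → W}

/-- The strong Bruhat order, generated by length-increasing multiplications by reflections. -/
def ReflLE (cs : CoxeterSystem M W) : W → W → Prop :=
  Relation.ReflTransGen fun u v => ∃ r, cs.IsReflection r ∧ v = r * u ∧ cs.length u < cs.length v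

theorem ReflLE.eq_or_length_lt {u v : W} (h : ReflLE cs u v) :
    u = v ∨ cs.length u < cs.length v := by
  induction h with
  | refl => exact Or.inl rfl
  | tail _ h ih =>
    obtain ⟨r, -, -, h⟩ := h
    rcases ih with rfl | ih
    · exact Or.inr h
    · exact Or.inr (ih.trans h)

theorem IsDemazure.reflLE_simple (hdem : IsDemazure cs dem) (i : B) (u : W) :
    ReflLE cs u (dem (cs.simple i) u) := by
  rcases hdem.simple_left i u with ⟨h, h'⟩ | ⟨h, h'⟩
  · rw [h]
    exact .single ⟨_, cs.isReflection_simple i, rfl, by omega⟩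
  · rw [h]
    exact .refl

theorem IsDemazure.reflLE_simple_mono (hdem : IsDemazure cs dem) (i : B) {u v : W}
    (h : ReflLE cs u v) : ReflLE cs (dem (cs.simple i) u) (dem (cs.simple i) v) := by
  induction h with
  | refl => exact .refl
  | @tail v x _ h ih =>
    refine ih.trans ?_
    clear ih
    obtain ⟨r, hr, rfl, hlt⟩ := h
    rcases hdem.simple_left i v with ⟨h1, h1'⟩ | ⟨h1, h1'⟩
    · by_cases hri : r = cs.simple i
      · subst hri
        rw [h1]
        exact hdem.reflLE_simple i _
      · have hlt' := hdem.length_simple_mul_lt hr hri hlt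
        have hstep : ReflLE cs (cs.simple i * v) (cs.simple i * (r * v)) :=
          .single ⟨_, hr.conj (cs.simple i), by simp [mul_assoc], hlt'⟩
        rw [h1]
        rcases hdem.simple_left i (r * v) with ⟨h2, h2'⟩ | ⟨h2, h2'⟩
        · rwa [h2]
        · rw [h2]
          refine hstep.tail ⟨_, cs.isReflection_simple i, ?_, by omega⟩
          simp
    · rw [h1]
      exact .head ⟨r, hr, rfl, hlt⟩ (hdem.reflLE_simple i _)

variable {ι : Type}

open Classical in
/-- The Demazure product of the letters of the word `l` at positions in `A`. -/
def subDem (cs : CoxeterSystem M W) (dem : W → W → W) (s : ι → B) (A : Finset ι) : List ι → W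
  | [] => 1
  | x :: l => if x ∈ A then dem (cs.simple (s x)) (subDem cs dem s A l) else subDem cs dem s A l

open Classical in
/-- The group product of the letters of the word `l` at positions in `A`. -/
def subProd (cs : CoxeterSystem M W) (s : ι → B) (A : Finset ι) : List ι → W
  | [] => 1
  | x :: l => if x ∈ A then cs.simple (s x) * subProd cs s A l else subProd cs s A l

open Classical in
/-- The number of letters of the word `l` at positions in `A`. -/
def subLen (A : Finset ι) (l : List ι) : ℕ := l.countP (· ∈ A)

@[simp] theorem subLen_nil (A : Finset ι) : subLen A [] = 0 := by simp [subLen]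

theorem subLen_cons_of_mem {A : Finset ι} {x : ι} (h : x ∈ A) (l : List ι) :
    subLen A (x :: l) = subLen A l + 1 := by simp [subLen, h]

theorem subLen_cons_of_notMem {A : Finset ι} {x : ι} (h : x ∉ A) (l : List ι) :
    subLen A (x :: l) = subLen A l := by simp [subLen, h]

theorem subLen_congr {A A' : Finset ι} {l : List ι} (h : ∀ x ∈ l, x ∈ A ↔ x ∈ A') :
    subLen A l = subLen A' l :=
  List.countP_congr (by simpa using h)

theorem subDem_cons_of_mem {A : Finset ι} {x : ι} (h : x ∈ A) (s : ι → B) (l : List ι) :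
    subDem cs dem s A (x :: l) = dem (cs.simple (s x)) (subDem cs dem s A l) := by
  simp [subDem, h]

theorem subDem_cons_of_notMem {A : Finset ι} {x : ι} (h : x ∉ A) (s : ι → B) (l : List ι) :
    subDem cs dem s A (x :: l) = subDem cs dem s A l := by simp [subDem, h]

theorem subDem_congr {A A' : Finset ι} {l : List ι} (s : ι → B)
    (h : ∀ x ∈ l, x ∈ A ↔ x ∈ A') : subDem cs dem s A l = subDem cs dem s A' l := by
  induction l with
  | nil => rfl
  | cons x l ih =>
    rw [List.forall_mem_cons] at h
    by_cases hx : x ∈ A' <;> simp [subDem, h.1, hx, ih h.2]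

theorem subProd_congr {A A' : Finset ι} {l : List ι} (s : ι → B)
    (h : ∀ x ∈ l, x ∈ A ↔ x ∈ A') : subProd cs s A l = subProd cs s A' l := by
  induction l with
  | nil => rfl
  | cons x l ih =>
    rw [List.forall_mem_cons] at h
    by_cases hx : x ∈ A' <;> simp [subProd, h.1, hx, ih h.2]

theorem length_subProd_le (s : ι → B) (A : Finset ι) (l : List ι) :
    cs.length (subProd cs s A l) ≤ subLen A l := by
  induction l with
  | nil => simp [subProd]
  | cons x l ih =>
    by_cases h : x ∈ A
    · have := cs.length_simple_mul (subProd cs s A l) (s x)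
      simp only [subProd, h, if_true, subLen_cons_of_mem]
      omega
    · simpa only [subProd, h, if_false, subLen_cons_of_notMem h] using ih

theorem IsDemazure.length_subDem_le (hdem : IsDemazure cs dem) (s : ι → B) (A : Finset ι)
    (l : List ι) : cs.length (subDem cs dem s A l) ≤ subLen A l := by
  induction l with
  | nil => simp [subDem]
  | cons x l ih =>
    by_cases h : x ∈ A
    · rw [subDem_cons_of_mem h, subLen_cons_of_mem h]
      rcases hdem.simple_left (s x) (subDem cs dem s A l) with ⟨h1, h2⟩ | ⟨h1, h2⟩ <;>
        rw [h1] <;> omega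
    · rwa [subDem_cons_of_notMem h, subLen_cons_of_notMem h]

theorem IsDemazure.subProd_eq_of_length_subDem (hdem : IsDemazure cs dem) {s : ι → B}
    {A : Finset ι} {l : List ι} (h : cs.length (subDem cs dem s A l) = subLen A l) :
    subProd cs s A l = subDem cs dem s A l := by
  induction l with
  | nil => rfl
  | cons x l ih =>
    by_cases hx : x ∈ A
    · rw [subDem_cons_of_mem hx, subLen_cons_of_mem hx] at h
      have := hdem.length_subDem_le s A l
      rcases hdem.simple_left (s x) (subDem cs dem s A l) with ⟨h1, h2⟩ | ⟨h1, h2⟩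
      · rw [subDem_cons_of_mem hx, h1, ← ih (by rw [h1] at h; omega)]
        simp [subProd, hx]
      · rw [h1] at h; omega
    · rw [subDem_cons_of_notMem hx, subLen_cons_of_notMem hx] at h
      rw [subDem_cons_of_notMem hx, ← ih h]
      simp [subProd, hx]

theorem IsDemazure.subProd_eq_of_length_subProd (hdem : IsDemazure cs dem) {s : ι → B}
    {A : Finset ι} {l : List ι} (h : cs.length (subProd cs s A l) = subLen A l) :
    subProd cs s A l = subDem cs dem s A l := by
  induction l with
  | nil => rfl
  | cons x l ih =>
    by_cases hx : x ∈ A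
    · simp only [subProd, hx, if_true, subLen_cons_of_mem] at h ⊢
      have h0 := length_subProd_le (cs := cs) s A l
      have h1 := cs.length_simple_mul (subProd cs s A l) (s x)
      rw [subDem_cons_of_mem hx, ← ih (by omega)]
      exact (hdem.eq_mul _ _ (by rw [cs.length_simple]; omega)).symm
    · simp only [subProd, hx, if_false, subLen_cons_of_notMem hx] at h ⊢
      rw [subDem_cons_of_notMem hx, ih h]

theorem IsDemazure.reflLE_subDem (hdem : IsDemazure cs dem) (s : ι → B) {A A' : Finset ι}
    (h : A ⊆ A') (l : List ι) : ReflLE cs (subDem cs dem s A l) (subDem cs dem s A' l) := by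
  induction l with
  | nil => exact .refl
  | cons x l ih =>
    by_cases hx : x ∈ A
    · rw [subDem_cons_of_mem hx, subDem_cons_of_mem (h hx)]
      exact hdem.reflLE_simple_mono _ ih
    · rw [subDem_cons_of_notMem hx]
      by_cases hx' : x ∈ A'
      · rw [subDem_cons_of_mem hx']
        exact ih.trans (hdem.reflLE_simple _ _)
      · rwa [subDem_cons_of_notMem hx']

section Erase

variable [DecidableEq ι]

theorem mem_erase_congr {A : Finset ι} {x : ι} {l : List ι} (h : x ∉ l) :
    ∀ y ∈ l, y ∈ A.erase x ↔ y ∈ A := by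
  intro y hy
  have : y ≠ x := by rintro rfl; exact h hy
  simp [this]

theorem subLen_erase {A : Finset ι} {x : ι} {l : List ι} (hl : l.Nodup) (hx : x ∈ l)
    (hA : x ∈ A) : subLen (A.erase x) l + 1 = subLen A l := by
  induction l with
  | nil => simp at hx
  | cons y l ih =>
    rw [List.nodup_cons] at hl
    by_cases hxy : x = y
    · subst hxy
      rw [subLen_cons_of_notMem (by simp), subLen_cons_of_mem hA,
        subLen_congr (mem_erase_congr hl.1)]
    · have ih := ih hl.2 (by simpa [hxy] using hx)
      by_cases hy : y ∈ A
      · rw [subLen_cons_of_mem (by simp [hy, Ne.symm hxy]), subLen_cons_of_mem hy, ih]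
      · rw [subLen_cons_of_notMem (by simp [hy]), subLen_cons_of_notMem hy, ih]

/-- The exchange condition for subwords. -/
theorem IsDemazure.exists_subProd_erase (hdem : IsDemazure cs dem) (s : ι → B) {A : Finset ι}
    {l : List ι} (hl : l.Nodup) {t : W} (ht : cs.IsReflection t)
    (hlt : cs.length (t * subProd cs s A l) < cs.length (subProd cs s A l)) :
    ∃ y ∈ l, y ∈ A ∧ subProd cs s (A.erase y) l = t * subProd cs s A l := by
  induction l generalizing t with
  | nil => simp [subProd] at hlt
  | cons x l ih =>
    rw [List.nodup_cons] at hl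
    by_cases hx : x ∈ A
    · simp only [subProd, hx, if_true] at hlt ⊢
      by_cases htx : t = cs.simple (s x)
      · refine ⟨x, by simp, hx, ?_⟩
        simp [htx, subProd_congr s (mem_erase_congr hl.1)]
      · have ht' := ht.conj (cs.simple (s x))
        obtain ⟨y, hy, hyA, h⟩ := ih hl.2 ht' (by
          by_contra hcon
          have hne := ht'.length_mul_right_ne (subProd cs s A l)
          have hne' : cs.simple (s x) * t * (cs.simple (s x))⁻¹ ≠ cs.simple (s x) := by
            intro h
            apply htx
            have := congrArg (fun z => cs.simple (s x) * z * cs.simple (s x)) h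
            simpa [mul_assoc] using this
          have := hdem.length_simple_mul_lt ht' hne' (u := subProd cs s A l) (by omega)
          simp [mul_assoc] at this
          omega)
        refine ⟨y, by simp [hy], hyA, ?_⟩
        have : x ≠ y := by rintro rfl; exact hl.1 hy
        simp [hx, this, h, mul_assoc]
    · simp only [subProd, hx, if_false] at hlt ⊢
      obtain ⟨y, hy, hyA, h⟩ := ih hl.2 ht hlt
      refine ⟨y, by simp [hy], hyA, ?_⟩
      simp [hx, h]

/-- Distinct deletions from a reduced subword have distinct products. -/
theorem subProd_erase_injective (s : ι → B) {A : Finset ι} {l : List ι}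
    (hl : l.Nodup) (hred : cs.length (subProd cs s A l) = subLen A l) {y z : ι}
    (hy : y ∈ l) (hyA : y ∈ A) (hz : z ∈ l) (hzA : z ∈ A)
    (h : subProd cs s (A.erase y) l = subProd cs s (A.erase z) l) : y = z := by
  induction l with
  | nil => simp at hy
  | cons x l ih =>
    rw [List.nodup_cons] at hl
    by_cases hx : x ∈ A
    · simp only [subProd, hx, if_true, subLen_cons_of_mem] at hred
      have h0 := length_subProd_le (cs := cs) s A l
      have h1 := cs.length_simple_mul (subProd cs s A l) (s x)
      have aux : ∀ z ∈ l, z ∈ A →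
          subProd cs s A l ≠ cs.simple (s x) * subProd cs s (A.erase z) l := by
        intro z hz hzA heq
        have h2 := length_subProd_le (cs := cs) s (A.erase z) l
        have h3 := subLen_erase hl.2 hz hzA
        rw [heq, cs.simple_mul_simple_cancel_left] at hred
        omega
      have hcong := subProd_congr (cs := cs) (A := A.erase x) (A' := A) s (mem_erase_congr hl.1)
      rw [List.mem_cons] at hy hz
      rcases hy with rfl | hy <;> rcases hz with rfl | hz
      · rfl
      · have hne : y ≠ z := by rintro rfl; exact hl.1 hz
        simp only [subProd, Finset.notMem_erase, if_false, Finset.mem_erase, hx, hne, ne_eq,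
          not_false_eq_true, and_self, if_true, hcong] at h
        exact (aux z hz hzA h).elim
      · have hne : z ≠ y := by rintro rfl; exact hl.1 hy
        simp only [subProd, Finset.notMem_erase, if_false, Finset.mem_erase, hx, hne, ne_eq,
          not_false_eq_true, and_self, if_true, hcong] at h
        exact (aux y hy hyA h.symm).elim
      · have hne : x ≠ y := by rintro rfl; exact hl.1 hy
        have hne' : x ≠ z := by rintro rfl; exact hl.1 hz
        simp only [subProd, Finset.mem_erase, hx, hne, hne', ne_eq,
          not_false_eq_true, and_self, if_true, mul_right_inj] at h
        exact ih hl.2 (by omega) hy hz h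
    · simp only [subProd, hx, if_false, subLen_cons_of_notMem hx, Finset.mem_erase, and_false]
        at hred h
      have hyx : y ≠ x := by rintro rfl; exact hx hyA
      have hzx : z ≠ x := by rintro rfl; exact hx hzA
      exact ih hl.2 hred (by simpa [hyx] using hy) (by simpa [hzx] using hz) h

theorem IsDemazure.exists_subDem_erase (hdem : IsDemazure cs dem) (s : ι → B) {A : Finset ι}
    {l : List ι} (hl : l.Nodup) (h : cs.length (subDem cs dem s A l) < subLen A l) :
    ∃ y ∈ l, y ∈ A ∧ subDem cs dem s (A.erase y) l = subDem cs dem s A l := by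
  induction l with
  | nil => simp at h
  | cons x l ih =>
    rw [List.nodup_cons] at hl
    by_cases hx : x ∈ A
    · rw [subDem_cons_of_mem hx, subLen_cons_of_mem hx] at h
      rcases hdem.simple_left (s x) (subDem cs dem s A l) with ⟨h1, h2⟩ | ⟨h1, h2⟩
      · obtain ⟨y, hy, hyA, h3⟩ := ih hl.2 (by rw [h1] at h; omega)
        have : x ≠ y := by rintro rfl; exact hl.1 hy
        refine ⟨y, by simp [hy], hyA, ?_⟩
        rw [subDem_cons_of_mem (by simp [hx, this]), subDem_cons_of_mem hx, h3]
      · refine ⟨x, by simp, hx, ?_⟩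
        rw [subDem_cons_of_notMem (by simp), subDem_cons_of_mem hx, h1,
          subDem_congr s (mem_erase_congr hl.1)]
    · rw [subDem_cons_of_notMem hx, subLen_cons_of_notMem hx] at h
      obtain ⟨y, hy, hyA, h3⟩ := ih hl.2 h
      refine ⟨y, by simp [hy], hyA, ?_⟩
      rw [subDem_cons_of_notMem (by simp [hx]), subDem_cons_of_notMem hx, h3]

/-- The left exchange condition for a reduced subword. -/
theorem IsDemazure.exists_subDem_erase_of_descent (hdem : IsDemazure cs dem) (s : ι → B)
    {A : Finset ι} {l : List ι} (hl : l.Nodup)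
    (hred : cs.length (subDem cs dem s A l) = subLen A l) {i : B}
    (hi : cs.length (cs.simple i * subDem cs dem s A l) < cs.length (subDem cs dem s A l)) :
    ∃ y ∈ l, y ∈ A ∧ subDem cs dem s (A.erase y) l = cs.simple i * subDem cs dem s A l := by
  have hP := hdem.subProd_eq_of_length_subDem hred
  obtain ⟨y, hy, hyA, h⟩ := hdem.exists_subProd_erase s hl (cs.isReflection_simple i)
    (by rwa [hP] : cs.length (_ * subProd cs s A l) < _)
  rw [hP] at h
  refine ⟨y, hy, hyA, ?_⟩
  rw [← h]
  refine (hdem.subProd_eq_of_length_subProd ?_).symm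
  have h1 := cs.length_simple_mul (subDem cs dem s A l) i
  have h2 := subLen_erase hl hy hyA
  rw [h]
  omega

/-- A subword one letter longer than its Demazure product can be shortened in exactly two ways. -/
theorem IsDemazure.exists_two_subDem_erase (hdem : IsDemazure cs dem) (s : ι → B)
    {A : Finset ι} {l : List ι} (hl : l.Nodup)
    (h : subLen A l = cs.length (subDem cs dem s A l) + 1) :
    ∃ a b, a ≠ b ∧ (a ∈ l ∧ a ∈ A) ∧ (b ∈ l ∧ b ∈ A) ∧ ∀ x ∈ l, x ∈ A →
      (subDem cs dem s (A.erase x) l = subDem cs dem s A l ↔ x = a ∨ x = b) := by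
  induction l with
  | nil => simp at h
  | cons x l ih =>
    rw [List.nodup_cons] at hl
    have hxl : ∀ y ∈ l, x ≠ y := by rintro y hy rfl; exact hl.1 hy
    by_cases hx : x ∈ A
    · rw [subDem_cons_of_mem hx, subLen_cons_of_mem hx] at h
      have hxer : subDem cs dem s (A.erase x) (x :: l) = subDem cs dem s A l := by
        rw [subDem_cons_of_notMem (by simp), subDem_congr s (mem_erase_congr hl.1)]
      have hyer : ∀ y ∈ l, subDem cs dem s (A.erase y) (x :: l) =
          dem (cs.simple (s x)) (subDem cs dem s (A.erase y) l) := fun y hy =>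
        subDem_cons_of_mem (by simp [hx, hxl y hy]) s l
      rcases hdem.simple_left (s x) (subDem cs dem s A l) with ⟨h1, h2⟩ | ⟨h1, h2⟩
      · obtain ⟨a, b, hab, ha, hb, hiff⟩ := ih hl.2 (by rw [h1] at h; omega)
        refine ⟨a, b, hab, by simp [ha], by simp [hb], ?_⟩
        intro y hy hyA
        rw [List.mem_cons] at hy
        rw [subDem_cons_of_mem hx]
        rcases hy with rfl | hy
        · rw [hxer, h1]
          simp only [hxl a ha.1, hxl b hb.1, or_self, iff_false]
          intro heq
          rw [← heq] at h2
          omega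
        · rw [hyer y hy, ← hiff y hy hyA]
          refine ⟨fun heq => ?_, fun heq => by rw [heq]⟩
          rcases (hdem.reflLE_subDem s (A.erase_subset y) l).eq_or_length_lt with h3 | h3
          · exact h3
          · rw [h1] at heq
            rcases hdem.simple_left (s x) (subDem cs dem s (A.erase y) l) with ⟨h4, h5⟩ | ⟨h4, h5⟩
            · rw [h4] at heq; rw [heq] at h5; omega
            · rw [h4] at heq; rw [← heq] at h2; omega
      · rw [h1] at h
        have hred : cs.length (subDem cs dem s A l) = subLen A l := by omega
        obtain ⟨b, hb, hbA, hbe⟩ := hdem.exists_subDem_erase_of_descent s hl.2 hred (i := s x)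
          (by omega)
        refine ⟨x, b, hxl b hb, by simp [hx], by simp [hb, hbA], ?_⟩
        intro y hy hyA
        rw [List.mem_cons] at hy
        rw [subDem_cons_of_mem hx, h1]
        rcases hy with rfl | hy
        · simp [hxer]
        · have hby : ∀ y ∈ l, y ∈ A → cs.length (subDem cs dem s (A.erase y) l) + 1 ≤
              cs.length (subDem cs dem s A l) := fun y hy hyA => by
            have := subLen_erase hl.2 hy hyA
            have := hdem.length_subDem_le s (A.erase y) l
            omega
          rw [hyer y hy]
          simp only [(hxl y hy).symm, false_or]
          constructor
          · intro heq
            have h3 := hby y hy hyA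
            have h4 : subDem cs dem s (A.erase y) l =
                cs.simple (s x) * subDem cs dem s A l := by
              rcases hdem.simple_left (s x) (subDem cs dem s (A.erase y) l) with
                ⟨h4, h5⟩ | ⟨h4, h5⟩
              · rw [← heq, h4]; simp
              · rw [h4] at heq; rw [heq] at h3; omega
            have hlen : ∀ y ∈ l, y ∈ A → subDem cs dem s (A.erase y) l =
                cs.simple (s x) * subDem cs dem s A l →
                subProd cs s (A.erase y) l = cs.simple (s x) * subDem cs dem s A l := by
              intro y hy hyA h
              rw [← h]
              refine hdem.subProd_eq_of_length_subDem ?_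
              have := subLen_erase hl.2 hy hyA
              rw [h]; omega
            refine subProd_erase_injective (cs := cs) s hl.2 ?_ hy hyA hb hbA ?_
            · rw [hdem.subProd_eq_of_length_subDem hred, hred]
            · rw [hlen y hy hyA h4, hlen b hb hbA hbe]
          · rintro rfl
            rw [hbe, hdem.eq_mul] <;> simp
            omega
    · rw [subDem_cons_of_notMem hx, subLen_cons_of_notMem hx] at h
      obtain ⟨a, b, hab, ha, hb, hiff⟩ := ih hl.2 h
      refine ⟨a, b, hab, by simp [ha], by simp [hb], ?_⟩
      intro y hy hyA
      rw [List.mem_cons] at hy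
      rcases hy with rfl | hy
      · exact (hx hyA).elim
      · rw [subDem_cons_of_notMem hx, subDem_cons_of_notMem (by simp [hx]), hiff y hy hyA]

end Erase

/-- If a reduced subword can be started at an earlier letter `p`, then `p` can be exchanged
against a later letter. -/
theorem IsDemazure.exists_exchange [LinearOrder ι] (hdem : IsDemazure cs dem) (s : ι → B)
    {A A' : Finset ι} {l : List ι} (hl : l.Pairwise (· < ·))
    (hA : cs.length (subDem cs dem s A l) = subLen A l)
    (hA' : cs.length (subDem cs dem s A' l) = subLen A' l)
    (heq : subDem cs dem s A l = subDem cs dem s A' l) {p : ι} (hp : p ∈ l) (hpA' : p ∈ A')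
    (hpA : p ∉ A) (hlt : ∀ x ∈ l, x < p → (x ∈ A ↔ x ∈ A')) :
    ∃ q ∈ A, p < q ∧ subDem cs dem s ((insert p A).erase q) l = subDem cs dem s A l := by
  induction l with
  | nil => simp at hp
  | cons x l ih =>
    rw [List.pairwise_cons] at hl
    have hnd : l.Nodup := hl.2.imp ne_of_lt
    rw [List.mem_cons] at hp
    rcases hp with rfl | hp
    · have hpl : p ∉ l := fun h => lt_irrefl _ (hl.1 p h)
      rw [subDem_cons_of_notMem hpA] at heq hA ⊢
      rw [subLen_cons_of_notMem hpA] at hA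
      rw [subDem_cons_of_mem hpA'] at heq hA'
      rw [subLen_cons_of_mem hpA'] at hA'
      have h0 := hdem.length_subDem_le s A' l
      have hdes : cs.length (cs.simple (s p) * subDem cs dem s A l) + 1 =
          cs.length (subDem cs dem s A l) := by
        rw [heq]
        rcases hdem.simple_left (s p) (subDem cs dem s A' l) with ⟨h1, h2⟩ | ⟨h1, h2⟩
        · rw [h1]; simp [h2]
        · rw [h1] at hA'; omega
      obtain ⟨q, hq, hqA, hqe⟩ := hdem.exists_subDem_erase_of_descent s hnd hA (i := s p)
        (by omega)
      refine ⟨q, hqA, hl.1 q hq, ?_⟩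
      have hpq : p ≠ q := (hl.1 q hq).ne
      rw [subDem_cons_of_mem (by simp [hpq]),
        subDem_congr (A' := A.erase q) s (fun y hy => by simp [(hl.1 y hy).ne']), hqe,
        hdem.eq_mul] <;> simp
      omega
    · have hxp := hl.1 p hp
      have hx := hlt x (by simp) hxp
      have hlt' : ∀ x ∈ l, x < p → (x ∈ A ↔ x ∈ A') := fun y hy => hlt y (by simp [hy])
      by_cases hxA : x ∈ A
      · have hxA' := hx.1 hxA
        rw [subDem_cons_of_mem hxA, subLen_cons_of_mem hxA] at hA
        rw [subDem_cons_of_mem hxA', subLen_cons_of_mem hxA'] at hA'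
        rw [subDem_cons_of_mem hxA, subDem_cons_of_mem hxA'] at heq
        have h0 := hdem.length_subDem_le s A l
        have h0' := hdem.length_subDem_le s A' l
        rcases hdem.simple_left (s x) (subDem cs dem s A l) with ⟨h1, h2⟩ | ⟨h1, h2⟩
        · rcases hdem.simple_left (s x) (subDem cs dem s A' l) with ⟨h1', h2'⟩ | ⟨h1', h2'⟩
          · rw [h1] at hA
            rw [h1'] at hA'
            rw [h1, h1', mul_right_inj] at heq
            obtain ⟨q, hqA, hpq, hq⟩ := ih hl.2 (by omega) (by omega) heq hp hlt'
            refine ⟨q, hqA, hpq, ?_⟩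
            rw [subDem_cons_of_mem (by simp [hxA, (hxp.trans hpq).ne]), subDem_cons_of_mem hxA, hq]
          · rw [h1'] at hA'; omega
        · rw [h1] at hA; omega
      · have hxA' := fun h => hxA (hx.2 h)
        rw [subDem_cons_of_notMem hxA, subLen_cons_of_notMem hxA] at hA
        rw [subDem_cons_of_notMem hxA', subLen_cons_of_notMem hxA'] at hA'
        rw [subDem_cons_of_notMem hxA, subDem_cons_of_notMem hxA'] at heq
        obtain ⟨q, hqA, hpq, hq⟩ := ih hl.2 hA hA' heq hp hlt'
        refine ⟨q, hqA, hpq, ?_⟩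
        rw [subDem_cons_of_notMem (by simp [hxA, hxp.ne]), subDem_cons_of_notMem hxA, hq]

end Subwords

/-! ### Graded posets -/

section Graded

variable {α : Type*} [PartialOrder α] {rk : α → ℕ}

/-- `rk` is a rank function of the poset `α`. -/
structure IsRankFunction (rk : α → ℕ) : Prop where
  strictMono : StrictMono rk
  exists_succ : ∀ x y, x < y → ∃ z, x < z ∧ z ≤ y ∧ rk z = rk x + 1

theorem IsRankFunction.eq_of_le (h : IsRankFunction rk) {x y : α} (hxy : x ≤ y)
    (hr : rk y ≤ rk x) : x = y := by
  rcases hxy.eq_or_lt with rfl | hlt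
  · rfl
  · have := h.strictMono hlt; omega

theorem IsRankFunction.covR_iff (h : IsRankFunction rk) {x y : α} :
    CovR (· ≤ ·) x y ↔ x ≤ y ∧ rk y = rk x + 1 := by
  constructor
  · rintro ⟨h1, h2, h3⟩
    obtain ⟨z, hz1, hz2, hz3⟩ := h.exists_succ x y (lt_of_le_of_ne h1 h2)
    rcases h3 z hz1.le hz2 with rfl | rfl
    · exact (lt_irrefl _ hz1).elim
    · exact ⟨h1, hz3⟩
  · rintro ⟨h1, h2⟩
    refine ⟨h1, by rintro rfl; omega, fun z hz1 hz2 => ?_⟩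
    have ha := h.strictMono.monotone hz1
    have hb := h.strictMono.monotone hz2
    by_cases hz : rk z = rk x
    · exact Or.inl (h.eq_of_le hz1 hz.le).symm
    · exact Or.inr (h.eq_of_le hz2 (by omega))

theorem IsRankFunction.exists_isMaxChainList (h : IsRankFunction rk) {x y : α} (hxy : x ≤ y) :
    ∃ l, IsMaxChainList (· ≤ ·) x y l := by
  obtain ⟨k, hk⟩ : ∃ k, rk y = rk x + k := ⟨_, (Nat.add_sub_of_le (h.strictMono.monotone hxy)).symm⟩
  induction k generalizing x with
  | zero =>
    obtain rfl := h.eq_of_le hxy (by omega)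
    exact ⟨[x], List.isChain_singleton _, rfl, rfl⟩
  | succ k ih =>
    obtain ⟨z, hz1, hz2, hz3⟩ := h.exists_succ x y (lt_of_le_of_ne hxy (by rintro rfl; omega))
    obtain ⟨l, hl1, hl2, hl3⟩ := ih hz2 (by omega)
    cases l with
    | nil => simp at hl2
    | cons w l =>
      obtain rfl : w = z := by simpa using hl2
      refine ⟨x :: w :: l, List.isChain_cons_cons.2 ⟨h.covR_iff.2 ⟨hz1.le, hz3⟩, hl1⟩, rfl, ?_⟩
      simpa using hl3

theorem IsRankFunction.length_of_isMaxChainList (h : IsRankFunction rk) {x y : α} {l : List α}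
    (hl : IsMaxChainList (· ≤ ·) x y l) : rk y + 1 = rk x + l.length := by
  obtain ⟨hl1, hl2, hl3⟩ := hl
  induction l generalizing x with
  | nil => simp at hl2
  | cons w l ih =>
    obtain rfl : w = x := by simpa using hl2
    cases l with
    | nil =>
      obtain rfl : w = y := by simpa using hl3
      simp
    | cons z l =>
      have hl1 := List.isChain_cons_cons.1 hl1
      have h1 := (h.covR_iff.1 hl1.1).2
      have h2 := ih (x := z) hl1.2 rfl (by simpa using hl3)
      simp only [List.length_cons] at h2 ⊢
      omega

theorem IsRankFunction.pureR (h : IsRankFunction rk) : PureR (α := α) (· ≤ ·) := by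
  refine fun x y hxy => ⟨h.exists_isMaxChainList hxy, fun l l' hl hl' => ?_⟩
  have := h.length_of_isMaxChainList hl
  have := h.length_of_isMaxChainList hl'
  omega

theorem IsRankFunction.thinR (h : IsRankFunction rk)
    (h2 : ∀ x y : α, x ≤ y → rk y = rk x + 2 → ∃ a b, a ≠ b ∧
      ∀ z, (x ≤ z ∧ z ≤ y ∧ rk z = rk x + 1) ↔ z = a ∨ z = b) :
    ThinR (α := α) (· ≤ ·) := by
  rintro x y ⟨z, hxz, hzy⟩
  rw [h.covR_iff] at hxz hzy
  have hxy := hxz.1.trans hzy.1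
  have hr : rk y = rk x + 2 := by omega
  obtain ⟨a, b, hab, hiff⟩ := h2 x y hxy hr
  have ha := (hiff a).2 (Or.inl rfl)
  have hb := (hiff b).2 (Or.inr rfl)
  have hset : {z | x ≤ z ∧ z ≤ y} = {x, a, b, y} := by
    ext w
    simp only [Set.mem_ofPred_eq, Set.mem_insert_iff, Set.mem_singleton_iff]
    constructor
    · rintro ⟨h3, h4⟩
      have h3' := h.strictMono.monotone h3
      have h4' := h.strictMono.monotone h4
      by_cases hw : rk w = rk x
      · exact Or.inl (h.eq_of_le h3 hw.le).symm
      by_cases hw' : rk w = rk x + 1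
      · have := (hiff w).1 ⟨h3, h4, hw'⟩
        tauto
      · have := h.eq_of_le h4 (by omega)
        tauto
    · rintro (rfl | rfl | rfl | rfl)
      · exact ⟨le_rfl, hxy⟩
      · exact ⟨ha.1, ha.2.1⟩
      · exact ⟨hb.1, hb.2.1⟩
      · exact ⟨hxy, le_rfl⟩
  have hne : ∀ {u v : α}, rk u ≠ rk v → u ≠ v := by rintro u _ h rfl; exact h rfl
  rw [hset, Set.ncard_insert_of_notMem, Set.ncard_insert_of_notMem, Set.ncard_pair]
  · exact hne (by omega)
  · simp only [Set.mem_insert_iff, Set.mem_singleton_iff, not_or]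
    exact ⟨hab, hne (by omega)⟩
  · simp only [Set.mem_insert_iff, Set.mem_singleton_iff, not_or]
    exact ⟨hne (by omega), hne (by omega), hne (by omega)⟩

theorem IsRankFunction.le_of_isChain (h : IsRankFunction rk) {c : Set α}
    (hc : IsChain (· ≤ ·) c) {x y : α} (hx : x ∈ c) (hy : y ∈ c) (hr : rk x ≤ rk y) : x ≤ y := by
  rcases hc.total hx hy with hle | hle
  · exact hle
  · exact (h.eq_of_le hle hr).ge

theorem IsMaxChainFinset.mem_of_forall {c : Finset α}
    (hc : IsMaxChainFinset (· ≤ ·) Set.univ c) {z : α} (hz : ∀ w ∈ c, z ≤ w ∨ w ≤ z) :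
    z ∈ c := by
  classical
  have := hc.2.2 (insert z c) (Set.subset_univ _)
    (by
      rw [Finset.coe_insert]
      exact hc.2.1.insert fun w hw _ => hz w hw) (Finset.subset_insert _ _)
  rw [this]
  exact Finset.mem_insert_self _ _

variable [BoundedOrder α]

theorem IsRankFunction.isMaxChainFinset (h : IsRankFunction rk) {c : Finset α}
    (hc : IsChain (· ≤ ·) (c : Set α)) (hall : ∀ m ≤ rk ⊤, ∃ x ∈ c, rk x = m) :
    IsMaxChainFinset (· ≤ ·) Set.univ c := by
  refine ⟨Set.subset_univ _, hc, fun c' _ hc' hcc' => hcc'.antisymm fun x hx => ?_⟩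
  obtain ⟨y, hy, hyx⟩ := hall (rk x) (h.strictMono.monotone le_top)
  have hle := h.le_of_isChain hc' (hcc' hy) hx hyx.le
  rwa [← h.eq_of_le hle hyx.ge]

theorem IsRankFunction.exists_mem_rk_eq (h : IsRankFunction rk) (h0 : rk ⊥ = 0) {c : Finset α}
    (hc : IsMaxChainFinset (· ≤ ·) Set.univ c) {m : ℕ} (hm : m ≤ rk ⊤) :
    ∃ x ∈ c, rk x = m := by
  classical
  have hbot : ⊥ ∈ c := hc.mem_of_forall fun w _ => Or.inl bot_le
  have htop : ⊤ ∈ c := hc.mem_of_forall fun w _ => Or.inr le_top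
  by_contra! hno
  have hb := hno _ hbot
  have ht := hno _ htop
  obtain ⟨x, hx, hxmax⟩ := (c.filter (rk · < m)).exists_max_image rk
    ⟨⊥, Finset.mem_filter.2 ⟨hbot, by omega⟩⟩
  obtain ⟨y, hy, hymin⟩ := (c.filter (m < rk ·)).exists_min_image rk
    ⟨⊤, Finset.mem_filter.2 ⟨htop, by omega⟩⟩
  simp only [Finset.mem_filter, and_imp] at hx hxmax hy hymin
  have hxy : x ≤ y := h.le_of_isChain hc.2.1 hx.1 hy.1 (by omega)
  obtain ⟨z, hz1, hz2, hz3⟩ := h.exists_succ x y (lt_of_le_of_ne hxy (by rintro rfl; omega))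
  have hz : z ∈ c := hc.mem_of_forall fun w hw => by
    rcases lt_trichotomy (rk w) m with hlt | heq | hgt
    · exact Or.inr ((h.le_of_isChain hc.2.1 hw hx.1 (hxmax w hw hlt)).trans hz1.le)
    · exact (hno w hw heq).elim
    · exact Or.inl (hz2.trans (h.le_of_isChain hc.2.1 hy.1 hw (hymin w hw hgt)))
  have := hno z hz
  have := hxmax z hz (by omega)
  omega

/-- Replacing one element of a maximal chain. -/
theorem IsRankFunction.isMaxChainFinset_swap [DecidableEq α] (h : IsRankFunction rk)
    (h0 : rk ⊥ = 0) {c : Finset α} (hc : IsMaxChainFinset (· ≤ ·) Set.univ c) {a b x z : α}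
    (ha : a ∈ c) (hb : b ∈ c) (hx : x ∈ c) (haz : a ≤ z) (hzb : z ≤ b) (hra : rk z = rk a + 1)
    (hrb : rk b = rk z + 1) (hrx : rk x = rk z) :
    IsMaxChainFinset (· ≤ ·) Set.univ (insert z (c.erase x)) := by
  refine h.isMaxChainFinset ?_ fun m hm => ?_
  · rw [Finset.coe_insert]
    refine IsChain.insert (hc.2.1.mono (by simp)) fun w hw _ => ?_
    have hw := Finset.mem_erase.1 (Finset.mem_coe.1 hw)
    rcases lt_trichotomy (rk w) (rk z) with hlt | heq | hgt
    · exact Or.inr ((h.le_of_isChain hc.2.1 hw.2 ha (by omega)).trans haz)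
    · have hle := h.le_of_isChain hc.2.1 hw.2 hx (by omega)
      exact (hw.1 (h.eq_of_le hle (by omega))).elim
    · exact Or.inl (hzb.trans (h.le_of_isChain hc.2.1 hb hw.2 (by omega)))
  · obtain ⟨y, hy, hym⟩ := h.exists_mem_rk_eq h0 hc hm
    by_cases hyx : y = x
    · exact ⟨z, by simp, by rw [← hym, hyx, hrx]⟩
    · exact ⟨y, by simp [hy, hyx], hym⟩

end Graded

/-- Shellability from a linear order on the maximal chains. -/
theorem shellableR_of_linearOrder {α T : Type*} [Fintype T] [LinearOrder T] {r : α → α → Prop}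
    {s : Set α} (g : T → Finset α) (hg : Function.Injective g)
    (hmem : ∀ c, IsMaxChainFinset r s c ↔ ∃ t, g t = c)
    (h : ∀ t t', t' < t → ∃ t'' < t, ∃ a ∈ g t, a ∉ g t' ∧ ∀ x ∈ g t, x ≠ a → x ∈ g t'') :
    ShellableR r s := by
  classical
  let e : Fin (Fintype.card T) ≃o T := Fintype.orderIsoFinOfCardEq T rfl
  refine ⟨Fintype.card T, fun k => g (e k), fun i j hij => e.injective (hg hij),
    fun c => (hmem c).trans ⟨fun ⟨t, ht⟩ => ⟨e.symm t, by simpa using ht⟩,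
      fun ⟨k, hk⟩ => ⟨e k, hk⟩⟩, fun k hk => ?_⟩
  have key : ∀ i < k, ∃ j < k, ∃ a ∈ g (e k), a ∉ g (e i) ∧ (g (e k)).erase a ⊆ g (e j) := by
    intro i hik
    obtain ⟨t, ht, a, ha, ha', hsub⟩ := h _ _ (e.lt_iff_lt.2 hik)
    refine ⟨e.symm t, by rwa [← e.lt_iff_lt, e.apply_symm_apply], a, ha, ha', fun x hx => ?_⟩
    rw [Finset.mem_erase] at hx
    simpa using hsub x hx.2 hx.1
  refine ⟨(g (e k)).filter fun a => ∃ j < k, (g (e k)).erase a ⊆ g (e j), ?_,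
    Finset.filter_subset _ _, fun c => ⟨?_, ?_⟩⟩
  · obtain ⟨j, hj, a, ha, -, hsub⟩ := key ⟨0, by omega⟩ hk
    exact ⟨a, Finset.mem_filter.2 ⟨ha, j, hj, hsub⟩⟩
  · rintro ⟨hck, i, hi, hci⟩
    obtain ⟨j, hj, a, ha, hai, hsub⟩ := key i hi
    refine ⟨a, Finset.mem_filter.2 ⟨ha, j, hj, hsub⟩, fun x hx => ⟨hck hx, ?_⟩⟩
    rintro rfl
    exact hai (hci hx)
  · rintro ⟨a, ha, hca⟩
    obtain ⟨ha, j, hj, hsub⟩ := Finset.mem_filter.1 ha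
    refine ⟨fun x hx => (hca hx).1, j, hj, fun x hx => hsub ?_⟩
    exact Finset.mem_erase.2 ⟨(hca hx).2, (hca hx).1⟩

/-- Shellability from an injective key on the maximal chains. -/
theorem shellableR_of_key {α L : Type*} [Finite α] [LinearOrder L] {r : α → α → Prop} {s : Set α}
    (κ : Finset α → L)
    (hκ : ∀ c c', IsMaxChainFinset r s c → IsMaxChainFinset r s c' → κ c = κ c' → c = c')
    (h : ∀ c c', IsMaxChainFinset r s c → IsMaxChainFinset r s c' → κ c' < κ c →
      ∃ c'', IsMaxChainFinset r s c'' ∧ κ c'' < κ c ∧ ∃ a ∈ c, a ∉ c' ∧ ∀ x ∈ c, x ≠ a → x ∈ c'') :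
    ShellableR r s := by
  classical
  have := Fintype.ofFinite α
  refine @shellableR_of_linearOrder α {c : Finset α // IsMaxChainFinset r s c} _
    (LinearOrder.lift' (fun c => κ c.1) fun c c' hcc' => Subtype.ext (hκ _ _ c.2 c'.2 hcc'))
    r s Subtype.val Subtype.val_injective (fun c => by simp) ?_
  rintro ⟨c, hc⟩ ⟨c', hc'⟩ hlt
  obtain ⟨c'', hc'', hlt'', hex⟩ := h c c' hc hc' hlt
  exact ⟨⟨c'', hc''⟩, hlt'', hex⟩

/-! ### Augmented families of sets -/

section Family

variable {n d : ℕ} {G : Set (Finset (Fin n))}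

/-- The combinatorial properties of the complements of the faces of a spherical subword complex
whose facets have complements of size `d`. -/
structure IsSphericalFamily (G : Set (Finset (Fin n))) (d : ℕ) : Prop where
  univ_mem : Finset.univ ∈ G
  mono : ∀ A A', A ∈ G → A ⊆ A' → A' ∈ G
  le_card : ∀ A ∈ G, d ≤ A.card
  exists_erase : ∀ A ∈ G, d < A.card → ∃ x ∈ A, A.erase x ∈ G
  thin : ∀ A ∈ G, A.card = d + 1 → ∃ a b, a ≠ b ∧ a ∈ A ∧ b ∈ A ∧
    ∀ x ∈ A, A.erase x ∈ G ↔ x = a ∨ x = b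
  flip : ∀ A ∈ G, ∀ A' ∈ G, A.card = d → A'.card = d → ∀ p ∈ A', p ∉ A →
    (∀ x < p, x ∈ A ↔ x ∈ A') → ∃ q ∈ A, p < q ∧ (insert p A).erase q ∈ G

theorem IsSphericalFamily.exists_subset_card_eq (hG : IsSphericalFamily G d)
    {A : Finset (Fin n)} (hA : A ∈ G) : ∃ A' ∈ G, A' ⊆ A ∧ A'.card = d := by
  induction A using Finset.strongInduction with
  | H A ih =>
    rcases (hG.le_card A hA).eq_or_lt with heq | hlt
    · exact ⟨A, hA, subset_rfl, heq.symm⟩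
    · obtain ⟨x, hx, hxG⟩ := hG.exists_erase A hA hlt
      obtain ⟨A', h1, h2, h3⟩ := ih _ (Finset.erase_ssubset hx) hxG
      exact ⟨A', h1, h2.trans (Finset.erase_subset _ _), h3⟩

variable {α : Type*} [PartialOrder α] [BoundedOrder α] {f : α → Finset (Fin n)}

/-- `f` identifies the poset `α` with `G`, ordered by inclusion, with an added minimum. -/
structure IsAugmentedFamily (G : Set (Finset (Fin n))) (f : α → Finset (Fin n)) : Prop where
  mem : ∀ x, x ≠ ⊥ → f x ∈ G
  le_iff : ∀ x y, x ≠ ⊥ → y ≠ ⊥ → (x ≤ y ↔ f x ⊆ f y)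
  surj : ∀ A ∈ G, ∃ x, x ≠ ⊥ ∧ f x = A

open Classical in
/-- The rank function of an augmented family. -/
def augRank (d : ℕ) (f : α → Finset (Fin n)) (x : α) : ℕ :=
  if x = ⊥ then 0 else (f x).card - d + 1

@[simp] theorem augRank_bot : augRank d f ⊥ = 0 := by simp [augRank]

theorem augRank_of_ne_bot {x : α} (hx : x ≠ ⊥) : augRank d f x = (f x).card - d + 1 := by
  simp [augRank, hx]

theorem ne_bot_of_augRank {x : α} {m : ℕ} (hm : 1 ≤ m) (h : augRank d f x = m) : x ≠ ⊥ := by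
  rintro rfl
  rw [augRank_bot] at h
  omega

theorem IsAugmentedFamily.eq_of_eq (hf : IsAugmentedFamily G f) {x y : α} (hx : x ≠ ⊥)
    (hy : y ≠ ⊥) (h : f x = f y) : x = y :=
  le_antisymm ((hf.le_iff x y hx hy).2 h.subset) ((hf.le_iff y x hy hx).2 h.superset)

theorem IsAugmentedFamily.finite (hf : IsAugmentedFamily G f) : Finite α := by
  classical
  refine Finite.of_injective (fun x : α => (decide (x = ⊥), f x)) fun x y h => ?_
  simp only [Prod.mk.injEq, decide_eq_decide] at h
  by_cases hx : x = ⊥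
  · rw [hx, h.1.1 hx]
  · exact hf.eq_of_eq hx (fun hy => hx (h.1.2 hy)) h.2

theorem IsAugmentedFamily.top_ne_bot (hf : IsAugmentedFamily G f) (hG : IsSphericalFamily G d) :
    (⊤ : α) ≠ ⊥ := by
  obtain ⟨x, hx, -⟩ := hf.surj _ hG.univ_mem
  intro h
  exact hx (le_bot_iff.1 (h ▸ le_top))

theorem IsAugmentedFamily.map_top (hf : IsAugmentedFamily G f) (hG : IsSphericalFamily G d) :
    f ⊤ = Finset.univ := by
  obtain ⟨x, hx, hxu⟩ := hf.surj _ hG.univ_mem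
  have := (hf.le_iff x ⊤ hx (hf.top_ne_bot hG)).1 le_top
  rw [hxu] at this
  exact Finset.univ_subset_iff.1 this

theorem IsAugmentedFamily.card_eq (hf : IsAugmentedFamily G f) (hG : IsSphericalFamily G d)
    {x : α} (hx : x ≠ ⊥) : (f x).card + 1 = d + augRank d f x := by
  have := hG.le_card _ (hf.mem x hx)
  rw [augRank_of_ne_bot hx]
  omega

theorem IsAugmentedFamily.isRankFunction (hf : IsAugmentedFamily G f)
    (hG : IsSphericalFamily G d) : IsRankFunction (augRank d f) where
  strictMono x y hxy := by
    have hy : y ≠ ⊥ := (bot_le.trans_lt hxy).ne'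
    have hy' := hf.card_eq hG hy
    by_cases hx : x = ⊥
    · subst hx
      rw [augRank_bot, augRank_of_ne_bot hy]
      omega
    · have hx' := hf.card_eq hG hx
      have hsub := (hf.le_iff x y hx hy).1 hxy.le
      have := Finset.card_lt_card
        (hsub.ssubset_of_ne fun h => hxy.ne (hf.eq_of_eq hx hy h))
      omega
  exists_succ x y hxy := by
    have hy : y ≠ ⊥ := (bot_le.trans_lt hxy).ne'
    by_cases hx : x = ⊥
    · subst hx
      obtain ⟨A, hA, hAs, hAc⟩ := hG.exists_subset_card_eq (hf.mem y hy)
      obtain ⟨z, hz, rfl⟩ := hf.surj A hA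
      refine ⟨z, bot_lt_iff_ne_bot.2 hz, (hf.le_iff z y hz hy).2 hAs, ?_⟩
      have := hf.card_eq hG hz
      rw [augRank_bot]
      omega
    · have hsub := (hf.le_iff x y hx hy).1 hxy.le
      obtain ⟨v, hv, hvx⟩ := Finset.exists_of_ssubset
        (hsub.ssubset_of_ne fun h => hxy.ne (hf.eq_of_eq hx hy h))
      obtain ⟨z, hz, hzv⟩ := hf.surj (insert v (f x))
        (hG.mono _ _ (hf.mem x hx) (Finset.subset_insert _ _))
      have h1 := hf.card_eq hG hx
      have h2 := hf.card_eq hG hz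
      rw [hzv, Finset.card_insert_of_notMem hvx] at h2
      refine ⟨z, lt_of_le_of_ne ?_ (by rintro rfl; omega), ?_, by omega⟩
      · rw [hf.le_iff x z hx hz, hzv]
        exact Finset.subset_insert _ _
      · rw [hf.le_iff z y hz hy, hzv]
        exact Finset.insert_subset hv hsub

theorem IsAugmentedFamily.thinR (hf : IsAugmentedFamily G f) (hG : IsSphericalFamily G d) :
    ThinR (α := α) (· ≤ ·) := by
  refine (hf.isRankFunction hG).thinR fun x y hxy hr => ?_
  have hy : y ≠ ⊥ := ne_bot_of_augRank (by omega) hr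
  have hyc := hf.card_eq hG hy
  by_cases hx : x = ⊥
  · subst hx
    rw [augRank_bot] at hr
    obtain ⟨a, b, hab, ha, hb, hiff⟩ := hG.thin _ (hf.mem y hy) (by omega)
    obtain ⟨za, hza, hza'⟩ := hf.surj _ ((hiff a ha).2 (Or.inl rfl))
    obtain ⟨zb, hzb, hzb'⟩ := hf.surj _ ((hiff b hb).2 (Or.inr rfl))
    refine ⟨za, zb, ?_, fun z => ⟨?_, ?_⟩⟩
    · rintro rfl
      exact hab (Finset.erase_injOn _ ha hb (hza'.symm.trans hzb'))
    · rintro ⟨-, hzy, hzr⟩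
      have hz : z ≠ ⊥ := ne_bot_of_augRank (by omega) hzr
      have hzc := hf.card_eq hG hz
      rw [augRank_bot] at hzr
      obtain ⟨v, hv, hvy⟩ := Finset.exists_eq_insert_iff.2
        ⟨(hf.le_iff z y hz hy).1 hzy, (by omega : _ = (f y).card)⟩
      have hzv : f z = (f y).erase v := by rw [← hvy, Finset.erase_insert hv]
      have hm := hf.mem z hz
      rw [hzv, hiff v (by simp [← hvy])] at hm
      rcases hm with rfl | rfl
      · exact Or.inl (hf.eq_of_eq hz hza (hzv.trans hza'.symm))
      · exact Or.inr (hf.eq_of_eq hz hzb (hzv.trans hzb'.symm))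
    · have aux : ∀ (w : α) (v : Fin n), v ∈ f y → w ≠ ⊥ → f w = (f y).erase v →
          ⊥ ≤ w ∧ w ≤ y ∧ augRank d f w = augRank d f ⊥ + 1 := by
        intro w v hv hw hwv
        refine ⟨bot_le, (hf.le_iff w y hw hy).2 (hwv ▸ Finset.erase_subset _ _), ?_⟩
        have h1 := hf.card_eq hG hw
        rw [hwv, Finset.card_erase_of_mem hv] at h1
        rw [augRank_bot]
        omega
      rintro (rfl | rfl)
      · exact aux _ a ha hza hza'
      · exact aux _ b hb hzb hzb'
  · have hxc := hf.card_eq hG hx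
    have hsub := (hf.le_iff x y hx hy).1 hxy
    have hcard : (f y \ f x).card = 2 := by
      rw [Finset.card_sdiff_of_subset hsub]; omega
    obtain ⟨a, b, hab, hs⟩ := Finset.card_eq_two.1 hcard
    have hmem : ∀ v, v ∈ f y ∧ v ∉ f x ↔ v = a ∨ v = b := fun v => by
      rw [← Finset.mem_sdiff, hs]; simp
    have ha := (hmem a).2 (Or.inl rfl)
    have hb := (hmem b).2 (Or.inr rfl)
    have hins : ∀ v, insert v (f x) ∈ G := fun v =>
      hG.mono _ _ (hf.mem x hx) (Finset.subset_insert _ _)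
    obtain ⟨za, hza, hza'⟩ := hf.surj _ (hins a)
    obtain ⟨zb, hzb, hzb'⟩ := hf.surj _ (hins b)
    refine ⟨za, zb, ?_, fun z => ⟨?_, ?_⟩⟩
    · rintro rfl
      have : a ∈ insert b (f x) := by rw [← hzb', hza']; simp
      simp [hab, ha.2] at this
    · rintro ⟨hxz, hzy, hzr⟩
      have hz : z ≠ ⊥ := ne_bot_of_augRank (by omega) hzr
      have hzc := hf.card_eq hG hz
      obtain ⟨v, hv, hvz⟩ := Finset.exists_eq_insert_iff.2
        ⟨(hf.le_iff x z hx hz).1 hxz, (by omega : _ = (f z).card)⟩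
      have hvy : v ∈ f y := (hf.le_iff z y hz hy).1 hzy (by simp [← hvz])
      rcases (hmem v).1 ⟨hvy, hv⟩ with rfl | rfl
      · exact Or.inl (hf.eq_of_eq hz hza (hvz.symm.trans hza'.symm))
      · exact Or.inr (hf.eq_of_eq hz hzb (hvz.symm.trans hzb'.symm))
    · have aux : ∀ (w : α) (v : Fin n), v ∈ f y ∧ v ∉ f x → w ≠ ⊥ → f w = insert v (f x) →
          x ≤ w ∧ w ≤ y ∧ augRank d f w = augRank d f x + 1 := by
        intro w v hv hw hwv
        refine ⟨(hf.le_iff x w hx hw).2 (hwv ▸ Finset.subset_insert _ _),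
          (hf.le_iff w y hw hy).2 (hwv ▸ Finset.insert_subset hv.1 hsub), ?_⟩
        have h1 := hf.card_eq hG hw
        rw [hwv, Finset.card_insert_of_notMem hv.2] at h1
        omega
      rintro (rfl | rfl)
      · exact aux _ a ha hza hza'
      · exact aux _ b hb hzb hzb'

end Family

/-! ### Flags of a spherical family -/

section Flags

variable {n d D : ℕ} {G : Set (Finset (Fin n))} {ℓ ℓ' : ℕ → Finset (Fin n)}

/-- `ℓ 0 ⊂ ⋯ ⊂ ℓ D` is a complete flag in the family `G`. -/
structure IsFlag (G : Set (Finset (Fin n))) (d D : ℕ) (ℓ : ℕ → Finset (Fin n)) : Prop where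
  mem : ∀ k ≤ D, ℓ k ∈ G
  card : ∀ k ≤ D, (ℓ k).card = d + k
  step : ∀ k < D, ℓ k ⊆ ℓ (k + 1)
  last : ℓ D = Finset.univ

theorem IsFlag.mono (h : IsFlag G d D ℓ) {i j : ℕ} (hij : i ≤ j) (hj : j ≤ D) : ℓ i ⊆ ℓ j := by
  induction j, hij using Nat.le_induction with
  | base => exact subset_rfl
  | succ j _ ih => exact (ih (by omega)).trans (h.step j hj)

theorem IsFlag.exists_insert (h : IsFlag G d D ℓ) {k : ℕ} (hk : k < D) :
    ∃ v, v ∉ ℓ k ∧ ℓ (k + 1) = insert v (ℓ k) := by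
  obtain ⟨v, hv, hvk⟩ := Finset.exists_eq_insert_iff.2 ⟨h.step k hk, by
    rw [h.card k hk.le, h.card (k + 1) hk]; rfl⟩
  exact ⟨v, hv, hvk.symm⟩

open Classical in
/-- The weight of an element added to a flag with first set `A`: the elements that can be
exchanged for a larger element of `A` come first. -/
def flagWeight (G : Set (Finset (Fin n))) (A : Finset (Fin n)) (v : Fin n) : ℕ :=
  if ∃ q ∈ A, v < q ∧ (insert v A).erase q ∈ G then v else n + v

theorem flagWeight_injective (A : Finset (Fin n)) : Function.Injective (flagWeight G A) := by
  intro v v' h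
  unfold flagWeight at h
  have := v.2
  have := v'.2
  split_ifs at h <;> exact Fin.ext (by omega)

/-- The key by which flags are ordered in the shelling. -/
def flagKey (G : Set (Finset (Fin n))) (D : ℕ) (ℓ : ℕ → Finset (Fin n)) :
    Lex (Fin n → Bool) ×ₗ Lex (Fin (D + 1) → ℕ) :=
  toLex (toLex fun x => decide (x ∉ ℓ 0),
    toLex fun k => ∑ v ∈ ℓ k, flagWeight G (ℓ 0) v)

theorem flagKey_congr (h : ∀ k ≤ D, ℓ k = ℓ' k) : flagKey G D ℓ = flagKey G D ℓ' := by
  unfold flagKey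
  rw [h 0 (Nat.zero_le _)]
  congr! 5 with k
  exact h k (by omega)

theorem IsFlag.eq_of_sum_eq (h : IsFlag G d D ℓ) (h' : IsFlag G d D ℓ') (h0 : ℓ 0 = ℓ' 0)
    {ρ : Fin n → ℕ} (hρ : Function.Injective ρ) {k : ℕ} (hk : k ≤ D)
    (hs : ∀ j ≤ k, ∑ v ∈ ℓ j, ρ v = ∑ v ∈ ℓ' j, ρ v) : ℓ k = ℓ' k := by
  induction k with
  | zero => exact h0
  | succ k ih =>
    have heq := ih (by omega) fun j hj => hs j (by omega)
    have hsk := hs (k + 1) le_rfl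
    obtain ⟨v, hv, hvk⟩ := h.exists_insert hk
    obtain ⟨v', hv', hvk'⟩ := h'.exists_insert hk
    rw [hvk, hvk', Finset.sum_insert hv, Finset.sum_insert hv', heq, add_left_inj] at hsk
    rw [hvk, hvk', heq, hρ hsk]

theorem IsFlag.eq_of_flagKey_eq (h : IsFlag G d D ℓ) (h' : IsFlag G d D ℓ')
    (hkey : flagKey G D ℓ = flagKey G D ℓ') {k : ℕ} (hk : k ≤ D) : ℓ k = ℓ' k := by
  simp only [flagKey, EmbeddingLike.apply_eq_iff_eq, Prod.mk.injEq, funext_iff,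
    decide_eq_decide, not_iff_not] at hkey
  have h0 : ℓ 0 = ℓ' 0 := Finset.ext hkey.1
  refine h.eq_of_sum_eq h' h0 (flagWeight_injective (G := G) (ℓ 0)) hk fun j hj => ?_
  simpa [h0] using hkey.2 ⟨j, by omega⟩

/-- Some level of the flag `ℓ` not shared with `ℓ'` can be replaced so as to decrease the key. -/
def HasDescent (G : Set (Finset (Fin n))) (d D : ℕ) (ℓ ℓ' : ℕ → Finset (Fin n)) : Prop :=
  ∃ m < D, ∃ A ∈ G, A.card = d + m ∧ (∀ k, k + 1 = m → ℓ k ⊆ A) ∧ A ⊆ ℓ (m + 1) ∧ ℓ m ≠ ℓ' m ∧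
    flagKey G D (Function.update ℓ m A) < flagKey G D ℓ

theorem flagKey_update_lt {m : ℕ} (hm : 0 < m) (hmD : m ≤ D) {A : Finset (Fin n)}
    (hA : ∑ v ∈ A, flagWeight G (ℓ 0) v < ∑ v ∈ ℓ m, flagWeight G (ℓ 0) v) :
    flagKey G D (Function.update ℓ m A) < flagKey G D ℓ := by
  rw [flagKey, flagKey, Function.update_of_ne hm.ne, Prod.Lex.toLex_lt_toLex]
  refine Or.inr ⟨rfl, Pi.toLex_strictMono (Pi.lt_def.2 ⟨fun k => ?_, ⟨m, by omega⟩, ?_⟩)⟩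
  · by_cases hk : (k : ℕ) = m
    · simpa [hk] using hA.le
    · simp [Function.update_of_ne hk]
  · simpa using hA

theorem IsFlag.hasDescent_of_weight_lt (hG : IsSphericalFamily G d) (h : IsFlag G d D ℓ)
    {k : ℕ} (hk : k < D) {v x : Fin n} (hv : v ∉ ℓ k) (hvk : ℓ (k + 1) = insert v (ℓ k))
    (hx : x ∉ ℓ (k + 1)) (hxv : flagWeight G (ℓ 0) x < flagWeight G (ℓ 0) v)
    (hx' : ∀ j, k + 1 ≤ j → j ≤ D → x ∈ ℓ' j) : HasDescent G d D ℓ ℓ' := by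
  classical
  let P : ℕ → Prop := fun j => k + 1 ≤ j ∧ j < D ∧ ∃ u ∉ ℓ j, ℓ (j + 1) = insert u (ℓ j) ∧
    flagWeight G (ℓ 0) u < flagWeight G (ℓ 0) v
  have hex : ∃ i, x ∈ ℓ (i + 1) ∧ k + 1 ≤ i ∧ i < D := by
    have hkD : k + 1 ≠ D := by
      rintro hkD
      rw [hkD, h.last] at hx
      exact hx (Finset.mem_univ _)
    exact ⟨D - 1, by rw [Nat.sub_add_cancel (by omega), h.last]; exact Finset.mem_univ _,
      by omega, by omega⟩
  obtain ⟨hi1, hi2, hi3⟩ := Nat.find_spec hex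
  set i := Nat.find hex with hi
  have hxle : ∀ j, k + 1 ≤ j → j ≤ i → x ∉ ℓ j := by
    intro j hkj hji hxj
    rcases hkj.eq_or_lt with rfl | hlt
    · exact hx hxj
    · refine Nat.find_min hex (m := j - 1) (by omega) ⟨?_, by omega, by omega⟩
      rwa [Nat.sub_add_cancel (by omega)]
  have hPi : P i := by
    obtain ⟨u, hu, hui⟩ := h.exists_insert hi3
    have : x = u := by
      rw [hui, Finset.mem_insert] at hi1
      exact hi1.resolve_right (hxle i hi2 le_rfl)
    exact ⟨hi2, hi3, u, hu, hui, this ▸ hxv⟩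
  have hP : ∃ j, P j := ⟨i, hPi⟩
  have hjmin := fun m => Nat.find_min hP (m := m)
  have hji : Nat.find hP ≤ i := Nat.find_min' hP hPi
  obtain ⟨hj1, hj2, u, hu, huj, huv⟩ := Nat.find_spec hP
  generalize Nat.find hP = j at *
  obtain ⟨j, rfl⟩ : ∃ j', j = j' + 1 := ⟨j - 1, by omega⟩
  obtain ⟨u', hu', huj'⟩ := h.exists_insert (k := j) (by omega)
  have hge : flagWeight G (ℓ 0) v ≤ flagWeight G (ℓ 0) u' := by
    rcases (show k ≤ j by omega).eq_or_lt with rfl | hlt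
    · have : v ∈ insert u' (ℓ k) := by rw [← huj', hvk]; simp
      rw [(Finset.mem_insert.1 this).resolve_right hv]
    · by_contra! hcon
      exact hjmin j (Nat.lt_succ_self j) ⟨hlt, by omega, u', hu', huj', hcon⟩
  have hsub := h.step j (by omega)
  have huj0 : u ∉ ℓ j := fun hmem => hu (hsub hmem)
  refine ⟨j + 1, hj2, insert u (ℓ j),
    hG.mono _ _ (h.mem j (by omega)) (Finset.subset_insert _ _), ?_, ?_, ?_, ?_, ?_⟩
  · rw [Finset.card_insert_of_notMem huj0, h.card j (by omega)]
    omega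
  · rintro k' hk'
    obtain rfl : k' = j := by omega
    exact Finset.subset_insert _ _
  · rw [huj]
    exact Finset.insert_subset_insert _ hsub
  · intro heq
    exact hxle _ hj1 hji (heq ▸ hx' _ hj1 hj2.le)
  · refine flagKey_update_lt (Nat.succ_pos _) hj2.le ?_
    rw [huj', Finset.sum_insert huj0, Finset.sum_insert hu']
    omega

theorem IsFlag.hasDescent (hG : IsSphericalFamily G d) (h : IsFlag G d D ℓ)
    (h' : IsFlag G d D ℓ') (hlt : flagKey G D ℓ' < flagKey G D ℓ) : HasDescent G d D ℓ ℓ' := by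
  rcases Prod.Lex.toLex_lt_toLex.1 hlt with hcode | ⟨hcode, hsum⟩
  · obtain ⟨p, hp1, hp2⟩ := hcode
    simp only [Pi.toLex_apply, Bool.lt_iff, decide_eq_false_iff_not, not_not,
      decide_eq_true_eq, decide_eq_decide, not_iff_not] at hp1 hp2
    obtain ⟨q, hq, hpq, hqG⟩ := hG.flip _ (h.mem 0 D.zero_le) _ (h'.mem 0 D.zero_le)
      (h.card 0 D.zero_le) (h'.card 0 D.zero_le) p hp2.1 hp2.2 fun x hx => (hp1 x hx).symm
    have hD : 0 < D := by
      refine Nat.pos_of_ne_zero fun hD => hp2.2 ?_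
      rw [← hD, h.last]
      exact Finset.mem_univ _
    have h0 : ℓ 0 ≠ ℓ' 0 := fun heq => hp2.2 (heq ▸ hp2.1)
    obtain ⟨v, hv, hv1⟩ := h.exists_insert hD
    by_cases hR : ∃ q ∈ ℓ 0, v < q ∧ (insert v (ℓ 0)).erase q ∈ G
    · obtain ⟨q', hq', hvq', hG'⟩ := hR
      refine ⟨0, hD, _, hG', ?_, by simp, ?_, h0, ?_⟩
      · rw [Finset.card_erase_of_mem (by simp [hq']), Finset.card_insert_of_notMem hv,
          h.card 0 D.zero_le]
        rfl
      · rw [hv1]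
        exact Finset.erase_subset _ _
      · refine Prod.Lex.toLex_lt_toLex.2 (Or.inl ⟨v, fun x hx => ?_, ?_⟩)
        · simp [hx.ne, (hx.trans hvq').ne]
        · simp [hvq'.ne, hv, Bool.lt_iff]
    · have hpR : ∃ q ∈ ℓ 0, p < q ∧ (insert p (ℓ 0)).erase q ∈ G := ⟨q, hq, hpq, hqG⟩
      refine h.hasDescent_of_weight_lt hG hD hv hv1 (x := p) ?_ ?_ fun j _ hj =>
        h'.mono j.zero_le hj hp2.1
      · rw [hv1, Finset.mem_insert, not_or]
        exact ⟨by rintro rfl; exact hR hpR, hp2.2⟩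
      · rw [flagWeight, flagWeight, if_pos hpR, if_neg hR]
        omega
  · have h0 : ℓ 0 = ℓ' 0 := by
      ext x
      have := congrFun hcode x
      simp only [Pi.toLex_apply, decide_eq_decide, not_iff_not] at this
      exact this.symm
    obtain ⟨⟨m, hm⟩, hm1, hm2⟩ := hsum
    simp only [Pi.toLex_apply, ← h0] at hm1 hm2
    obtain ⟨k, rfl⟩ : ∃ k, m = k + 1 := by
      refine Nat.exists_eq_succ_of_ne_zero ?_
      rintro rfl
      rw [h0] at hm2
      exact lt_irrefl _ hm2
    have hk : ℓ k = ℓ' k := h.eq_of_sum_eq h' h0 (flagWeight_injective (G := G) (ℓ 0)) (by omega)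
      fun j hj => (hm1 ⟨j, by omega⟩ (Fin.mk_lt_mk.2 (by omega))).symm
    obtain ⟨v, hv, hvk⟩ := h.exists_insert (k := k) (by omega)
    obtain ⟨v', hv', hvk'⟩ := h'.exists_insert (k := k) (by omega)
    rw [hvk, hvk', Finset.sum_insert hv, Finset.sum_insert hv', hk, add_lt_add_iff_right] at hm2
    refine h.hasDescent_of_weight_lt hG (by omega) hv hvk (x := v') ?_ hm2 fun j hj hjD => ?_
    · rw [hvk, Finset.mem_insert, not_or, hk]
      exact ⟨by rintro rfl; exact lt_irrefl _ hm2, hv'⟩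
    · refine h'.mono hj hjD ?_
      rw [hvk']
      exact Finset.mem_insert_self _ _

end Flags
/-! ### Shellability of augmented families -/

section Shelling

variable {n d : ℕ} {G : Set (Finset (Fin n))} {α : Type*} [PartialOrder α] [BoundedOrder α]
  {f : α → Finset (Fin n)} {c c' : Finset α}

open Classical in
/-- The `k`-th set of the flag given by a maximal chain of an augmented family. -/
def chainFlag (d : ℕ) (f : α → Finset (Fin n)) (c : Finset α) (k : ℕ) : Finset (Fin n) :=
  (c.filter fun x => augRank d f x = k + 1).biUnion f

theorem IsAugmentedFamily.chainFlag_eq (hf : IsAugmentedFamily G f) (hG : IsSphericalFamily G d)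
    (hc : IsMaxChainFinset (· ≤ ·) Set.univ c) {x : α} (hx : x ∈ c) {k : ℕ}
    (hk : augRank d f x = k + 1) : chainFlag d f c k = f x := by
  classical
  have : c.filter (fun y => augRank d f y = k + 1) = {x} := by
    ext y
    rw [Finset.mem_filter, Finset.mem_singleton]
    constructor
    · rintro ⟨hy, hyk⟩
      have hrk := hf.isRankFunction hG
      exact hrk.eq_of_le (hrk.le_of_isChain hc.2.1 hy hx (by omega)) (by omega)
    · rintro rfl
      exact ⟨hx, hk⟩
  rw [chainFlag, this, Finset.singleton_biUnion]

theorem IsAugmentedFamily.exists_mem_chainFlag (hf : IsAugmentedFamily G f)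
    (hG : IsSphericalFamily G d) (hc : IsMaxChainFinset (· ≤ ·) Set.univ c) {k : ℕ}
    (hk : k + 1 ≤ augRank d f (⊤ : α)) :
    ∃ x ∈ c, x ≠ ⊥ ∧ augRank d f x = k + 1 ∧ f x = chainFlag d f c k := by
  obtain ⟨x, hx, hxk⟩ := (hf.isRankFunction hG).exists_mem_rk_eq augRank_bot hc hk
  exact ⟨x, hx, ne_bot_of_augRank (by omega) hxk, hxk, (hf.chainFlag_eq hG hc hx hxk).symm⟩

theorem IsAugmentedFamily.isFlag_chainFlag (hf : IsAugmentedFamily G f)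
    (hG : IsSphericalFamily G d) (hc : IsMaxChainFinset (· ≤ ·) Set.univ c) {D : ℕ}
    (hD : augRank d f (⊤ : α) = D + 1) : IsFlag G d D (chainFlag d f c) where
  mem k hk := by
    obtain ⟨x, -, hx, -, hxk⟩ := hf.exists_mem_chainFlag hG hc (k := k) (by omega)
    exact hxk ▸ hf.mem x hx
  card k hk := by
    obtain ⟨x, -, hx, hxr, hxk⟩ := hf.exists_mem_chainFlag hG hc (k := k) (by omega)
    have := hf.card_eq hG hx
    rw [← hxk]
    omega
  step k hk := by
    obtain ⟨x, hxc, hx, hxr, hxk⟩ := hf.exists_mem_chainFlag hG hc (k := k) (by omega)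
    obtain ⟨y, hyc, hy, hyr, hyk⟩ := hf.exists_mem_chainFlag hG hc (k := k + 1) (by omega)
    rw [← hxk, ← hyk, ← hf.le_iff x y hx hy]
    exact (hf.isRankFunction hG).le_of_isChain hc.2.1 hxc hyc (by omega)
  last := by
    rw [hf.chainFlag_eq hG hc (hc.mem_of_forall fun w _ => Or.inr le_top) hD, hf.map_top hG]

theorem IsAugmentedFamily.subset_of_chainFlag_eq (hf : IsAugmentedFamily G f)
    (hG : IsSphericalFamily G d) (hc : IsMaxChainFinset (· ≤ ·) Set.univ c)
    (hc' : IsMaxChainFinset (· ≤ ·) Set.univ c') {D : ℕ} (hD : augRank d f (⊤ : α) = D + 1)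
    (h : ∀ k ≤ D, chainFlag d f c k = chainFlag d f c' k) : c ⊆ c' := by
  intro x hx
  by_cases hxb : x = ⊥
  · rw [hxb]
    exact hc'.mem_of_forall fun w _ => Or.inl bot_le
  · have hle : augRank d f x ≤ augRank d f (⊤ : α) :=
      (hf.isRankFunction hG).strictMono.monotone le_top
    obtain ⟨k, hk⟩ : ∃ k, augRank d f x = k + 1 := ⟨_, augRank_of_ne_bot hxb⟩
    obtain ⟨y, hyc, hy, -, hyk⟩ := hf.exists_mem_chainFlag hG hc' (k := k) (by omega)
    rw [← h k (by omega), hf.chainFlag_eq hG hc hx hk] at hyk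
    exact hf.eq_of_eq hy hxb hyk ▸ hyc

theorem IsAugmentedFamily.exists_swap (hf : IsAugmentedFamily G f) (hG : IsSphericalFamily G d)
    (hc : IsMaxChainFinset (· ≤ ·) Set.univ c) {D : ℕ} (hD : augRank d f (⊤ : α) = D + 1)
    {m : ℕ} (hm : m < D) {A : Finset (Fin n)} (hA : A ∈ G) (hAc : A.card = d + m)
    (hlo : ∀ k, k + 1 = m → chainFlag d f c k ⊆ A) (hhi : A ⊆ chainFlag d f c (m + 1)) :
    ∃ c'', IsMaxChainFinset (· ≤ ·) Set.univ c'' ∧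
      (∀ k ≤ D, chainFlag d f c'' k = Function.update (chainFlag d f c) m A k) ∧
      ∃ a ∈ c, augRank d f a = m + 1 ∧ ∀ x ∈ c, x ≠ a → x ∈ c'' := by
  classical
  have hrk := hf.isRankFunction hG
  obtain ⟨z, hz, hzA⟩ := hf.surj A hA
  have hzr : augRank d f z = m + 1 := by
    have := hf.card_eq hG hz
    rw [hzA] at this
    omega
  obtain ⟨a, hac, ha, har, hak⟩ := hf.exists_mem_chainFlag hG hc (k := m) (by omega)
  obtain ⟨y, hyc, hy, hyr, hyk⟩ := hf.exists_mem_chainFlag hG hc (k := m + 1) (by omega)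
  have hzy : z ≤ y := by rwa [hf.le_iff z y hz hy, hzA, hyk]
  obtain ⟨w, hwc, hwz, hwr⟩ : ∃ w ∈ c, w ≤ z ∧ augRank d f z = augRank d f w + 1 := by
    cases m with
    | zero => exact ⟨⊥, hc.mem_of_forall fun w _ => Or.inl bot_le, bot_le, by rw [augRank_bot, hzr]⟩
    | succ k =>
      obtain ⟨w, hwc, hw, hwr, hwk⟩ := hf.exists_mem_chainFlag hG hc (k := k) (by omega)
      refine ⟨w, hwc, ?_, by omega⟩
      rw [hf.le_iff w z hw hz, hzA, hwk]
      exact hlo k rfl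
  have hc'' := hrk.isMaxChainFinset_swap augRank_bot hc hwc hyc hac hwz hzy hwr (by omega)
    (by omega)
  refine ⟨_, hc'', fun k hk => ?_, a, hac, har, fun x hx hxa => by simp [hx, hxa]⟩
  by_cases hkm : k = m
  · rw [hkm, Function.update_self, hf.chainFlag_eq hG hc'' (Finset.mem_insert_self _ _) hzr, hzA]
  · obtain ⟨x, hxc, hx, hxr, hxk⟩ := hf.exists_mem_chainFlag hG hc (k := k) (by omega)
    rw [Function.update_of_ne hkm, ← hxk]
    refine hf.chainFlag_eq hG hc'' (Finset.mem_insert_of_mem (Finset.mem_erase.2 ⟨?_, hxc⟩)) hxr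
    rintro rfl
    omega

theorem IsAugmentedFamily.shellableR (hf : IsAugmentedFamily G f) (hG : IsSphericalFamily G d) :
    ShellableR (α := α) (· ≤ ·) Set.univ := by
  have := hf.finite
  obtain ⟨D, hD⟩ : ∃ D, augRank d f (⊤ : α) = D + 1 :=
    ⟨_, augRank_of_ne_bot (hf.top_ne_bot hG)⟩
  refine shellableR_of_key (fun c => flagKey G D (chainFlag d f c)) ?_ ?_
  · intro c c' hc hc' hkey
    have heq : ∀ k ≤ D, chainFlag d f c k = chainFlag d f c' k := fun k hk =>
      (hf.isFlag_chainFlag hG hc hD).eq_of_flagKey_eq (hf.isFlag_chainFlag hG hc' hD) hkey hk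
    exact (hf.subset_of_chainFlag_eq hG hc hc' hD heq).antisymm
      (hf.subset_of_chainFlag_eq hG hc' hc hD fun k hk => (heq k hk).symm)
  · intro c c' hc hc' hlt
    obtain ⟨m, hm, A, hA, hAc, hlo, hhi, hne, hkey⟩ :=
      (hf.isFlag_chainFlag hG hc hD).hasDescent hG (hf.isFlag_chainFlag hG hc' hD) hlt
    obtain ⟨c'', hc'', hflag, a, hac, har, hsub⟩ :=
      hf.exists_swap hG hc hD hm hA hAc hlo hhi
    refine ⟨c'', hc'', (flagKey_congr hflag).trans_lt hkey, a, hac, fun hac' => hne ?_, hsub⟩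
    rw [hf.chainFlag_eq hG hc hac har, hf.chainFlag_eq hG hc' hac' har]

end Shelling
/-! ### Subwords with a given Demazure product -/

section Braid

variable {B W : Type} [Group W] {M : CoxeterMatrix B} {cs : CoxeterSystem M W}
  {dem : W → W → W} {n : ℕ}

theorem bruhatLE_refl (w : W) : BruhatLE cs w w := by
  obtain ⟨ω, h, hw⟩ := cs.exists_isReduced w
  exact ⟨ω, h, hw.symm, ω, List.Sublist.refl _, hw.symm⟩

theorem bruhatLE_one_left (w : W) : BruhatLE cs 1 w := by
  obtain ⟨ω, h, hw⟩ := cs.exists_isReduced w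
  exact ⟨ω, h, hw.symm, [], List.nil_sublist _, cs.wordProd_nil⟩

theorem bruhatLE_one_right_iff {v : W} : BruhatLE cs v 1 ↔ v = 1 := by
  refine ⟨?_, fun h => h ▸ bruhatLE_refl _⟩
  rintro ⟨ω, h, hw, ω', hsub, rfl⟩
  have hlen : ω.length = 0 := by rw [← h, hw, cs.length_one]
  obtain rfl := List.length_eq_zero_iff.1 hlen
  obtain rfl := List.sublist_nil.1 hsub
  exact cs.wordProd_nil

theorem bruhatLE_simple_iff {v : W} {i : B} :
    BruhatLE cs v (cs.simple i) ↔ v = 1 ∨ v = cs.simple i := by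
  constructor
  · rintro ⟨ω, h, hw, ω', hsub, rfl⟩
    have hlen : ω.length = 1 := by rw [← h, hw, cs.length_simple]
    obtain ⟨j, rfl⟩ := List.length_eq_one_iff.1 hlen
    rcases List.sublist_singleton.1 hsub with rfl | rfl
    · exact Or.inl cs.wordProd_nil
    · exact Or.inr hw
  · rintro (rfl | rfl)
    · exact bruhatLE_one_left _
    · exact bruhatLE_refl _

theorem simple_ne_one (i : B) : cs.simple i ≠ 1 := by
  intro h
  have := cs.length_simple i
  rw [h, cs.length_one] at this
  exact zero_ne_one this

theorem subLen_finRange (A : Finset (Fin n)) : subLen A (List.finRange n) = A.card := by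
  classical
  rw [subLen, List.countP_eq_length_filter,
    ← List.toFinset_card_of_nodup ((List.nodup_finRange n).filter _)]
  congr 1
  ext x
  simp

/-- The positions of subwords with the same Demazure product as the whole word. -/
def fullSubwords (cs : CoxeterSystem M W) (dem : W → W → W) (s : Fin n → B) :
    Set (Finset (Fin n)) :=
  {A | subDem cs dem s A (List.finRange n) = subDem cs dem s Finset.univ (List.finRange n)}

theorem IsDemazure.isSphericalFamily (hdem : IsDemazure cs dem) (s : Fin n → B) :
    IsSphericalFamily (fullSubwords cs dem s)
      (cs.length (subDem cs dem s Finset.univ (List.finRange n))) where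
  univ_mem := rfl
  mono A A' hA hsub := by
    have h1 := hdem.reflLE_subDem s hsub (List.finRange n)
    have h2 := hdem.reflLE_subDem s A'.subset_univ (List.finRange n)
    rw [fullSubwords, Set.mem_ofPred_eq] at hA ⊢
    rw [hA] at h1
    rcases h1.eq_or_length_lt with h1 | h1
    · exact h1.symm
    · rcases h2.eq_or_length_lt with h2 | h2
      · exact h2
      · exact absurd h1 h2.asymm
  le_card A hA := by
    rw [← subLen_finRange, ← show _ = _ from hA]
    exact hdem.length_subDem_le s A _
  exists_erase A hA hlt := by
    rw [← subLen_finRange, ← show _ = _ from hA] at hlt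
    obtain ⟨y, -, hy, h⟩ := hdem.exists_subDem_erase s (List.nodup_finRange n) hlt
    exact ⟨y, hy, h.trans hA⟩
  thin A hA hc := by
    rw [← subLen_finRange, ← show _ = _ from hA] at hc
    obtain ⟨a, b, hab, ha, hb, h⟩ := hdem.exists_two_subDem_erase s (List.nodup_finRange n) hc
    refine ⟨a, b, hab, ha.2, hb.2, fun x hx => ?_⟩
    rw [← h x (List.mem_finRange x) hx, show _ = _ from hA]
    rfl
  flip A hA A' hA' hc hc' p hp hpA hlt := by
    rw [← subLen_finRange, ← show _ = _ from hA] at hc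
    rw [← subLen_finRange, ← show _ = _ from hA'] at hc'
    obtain ⟨q, hq, hpq, h⟩ := hdem.exists_exchange s (List.pairwise_lt_finRange n) hc.symm hc'.symm
      (hA.trans hA'.symm) (List.mem_finRange p) hp hpA fun x _ hx => hlt x hx
    exact ⟨q, hq, hpq, h.trans hA⟩

open Classical in
/-- The subword of `s` with letters at the positions in `A`. -/
def subword (cs : CoxeterSystem M W) (s : Fin n → B) (A : Finset (Fin n)) (i : Fin n) : W :=
  if i ∈ A then cs.simple (s i) else 1

theorem IsDemazure.demProd_subword (hdem : IsDemazure cs dem) (s : Fin n → B)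
    (A : Finset (Fin n)) :
    demProd dem (subword cs s A) = subDem cs dem s A (List.finRange n) := by
  rw [demProd, List.ofFn_eq_map]
  induction List.finRange n with
  | nil => rfl
  | cons x l ih =>
    rw [List.map_cons, List.foldr_cons, ih]
    by_cases hx : x ∈ A
    · rw [subDem_cons_of_mem hx, subword, if_pos hx]
    · rw [subDem_cons_of_notMem hx, subword, if_neg hx, hdem.one_left]

theorem subword_univ (s : Fin n → B) :
    subword cs s Finset.univ = fun i => cs.simple (s i) := by
  ext i
  simp [subword]

theorem seqLE_subword_iff {s : Fin n → B} {A A' : Finset (Fin n)} :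
    seqLE cs (subword cs s A) (subword cs s A') ↔ A ⊆ A' := by
  refine forall_congr' fun i => ?_
  by_cases hi : i ∈ A <;> by_cases hi' : i ∈ A' <;>
    simp [subword, hi, hi', bruhatLE_refl, bruhatLE_one_left, bruhatLE_one_right_iff,
      simple_ne_one]

open Classical in
/-- The positions of the nontrivial entries of a sequence. -/
def seqSupport (v : Fin n → W) : Finset (Fin n) := Finset.univ.filter fun i => v i ≠ 1

theorem seqSupport_subword (s : Fin n → B) (A : Finset (Fin n)) :
    seqSupport (subword cs s A) = A := by
  ext i
  by_cases hi : i ∈ A <;> simp [seqSupport, subword, hi, simple_ne_one]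

theorem subword_seqSupport {s : Fin n → B} {v : Fin n → W}
    (hv : seqLE cs v fun i => cs.simple (s i)) : subword cs s (seqSupport v) = v := by
  ext i
  rcases bruhatLE_simple_iff.1 (hv i) with h | h <;> simp [seqSupport, subword, h, simple_ne_one]

/-- The elements of the augmented face poset of the braid variety. -/
abbrev BraidFace (cs : CoxeterSystem M W) (dem : W → W → W) (s : Fin n → B) : Type :=
  Option {s' : Fin n → W // seqLE cs s' (fun i => cs.simple (s i)) ∧
    demProd dem s' = demProd dem fun i => cs.simple (s i)}

/-- The positions of the letters of a face. -/
def faceSupport {s : Fin n → B} (x : BraidFace cs dem s) : Finset (Fin n) :=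
  x.elim ∅ fun p => seqSupport p.1

theorem qhatBraid_some_iff {s : Fin n → B} (p q : {s' : Fin n → W //
      seqLE cs s' (fun i => cs.simple (s i)) ∧
      demProd dem s' = demProd dem fun i => cs.simple (s i)}) :
    QhatBraid cs dem s (some p) (some q) ↔ seqSupport p.1 ⊆ seqSupport q.1 := by
  rw [← seqLE_subword_iff (cs := cs) (s := s), subword_seqSupport p.2.1,
    subword_seqSupport q.2.1]
  rfl

end Braid

/-- **Bao–He, §`subsec:braid`(a)**: the augmented face poset `Q̂_{m_∗(s̲),s̲}` of the
braid variety is graded (pure), thin, and shellable. -/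
theorem statement_16
    {B W : Type} [Group W] {M : CoxeterMatrix B}
    (cs : CoxeterSystem M W) (dem : W → W → W) (hdem : IsDemazure cs dem)
    (n : ℕ) (s : Fin n → B) :
    PureR (QhatBraid cs dem s) ∧ ThinR (QhatBraid cs dem s) ∧
    ShellableR (QhatBraid cs dem s) Set.univ := by
  let inst : PartialOrder (BraidFace cs dem s) :=
    { le := QhatBraid cs dem s
      le_refl := by
        rintro (_ | p)
        · trivial
        · exact (qhatBraid_some_iff p p).2 subset_rfl
      le_trans := by
        rintro (_ | p) (_ | q) (_ | r) h h' <;> try trivial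
        rw [qhatBraid_some_iff] at h h' ⊢
        exact h.trans h'
      le_antisymm := by
        rintro (_ | p) (_ | q) h h' <;> try trivial
        rw [qhatBraid_some_iff] at h h'
        rw [Option.some_inj, Subtype.ext_iff, ← subword_seqSupport p.2.1, h.antisymm h',
          subword_seqSupport q.2.1] }
  let inst' : BoundedOrder (BraidFace cs dem s) :=
    { bot := none
      bot_le := fun _ => trivial
      top := some ⟨_, fun _ => bruhatLE_refl _, rfl⟩
      le_top := by
        rintro (_ | p)
        · trivial
        · exact p.2.1 }
  have hne : ∀ x : BraidFace cs dem s, x ≠ ⊥ → ∃ p, x = some p := by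
    rintro (_ | p) h
    · exact (h rfl).elim
    · exact ⟨p, rfl⟩
  have hG := hdem.isSphericalFamily s
  have hf : IsAugmentedFamily (fullSubwords cs dem s) (faceSupport (cs := cs) (s := s)) :=
    { mem := by
        intro x hx
        obtain ⟨⟨v, hv, h⟩, rfl⟩ := hne x hx
        rwa [← subword_univ, ← subword_seqSupport hv, hdem.demProd_subword,
          hdem.demProd_subword] at h
      le_iff := by
        intro x y hx hy
        obtain ⟨p, rfl⟩ := hne x hx
        obtain ⟨q, rfl⟩ := hne y hy
        exact qhatBraid_some_iff p q
      surj := by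
        intro A hA
        refine ⟨some ⟨subword cs s A, ?_, ?_⟩, Option.some_ne_none _, seqSupport_subword s A⟩
        · rw [← subword_univ, seqLE_subword_iff]
          exact A.subset_univ
        · rw [← subword_univ, hdem.demProd_subword, hdem.demProd_subword]
          exact hA }
  exact ⟨(hf.isRankFunction hG).pureR, hf.thinR hG, hf.shellableR hG⟩

end TotPos
end
end
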